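/- arXiv:1209.3459 — 2 statements merged into one kernel-verified Lean document; each statement's English description precedes it below -/
import Mathlib

section
/- If B is an infinite-dimensional unital C*-algebra, then there exist a sequence (a_n) of pairwise orthogonal elements of B with 0 \le a_n \le 1_B, and a sequence of states (\phi_n) on B, such that \phi_n(a_n) = 1 for all n and \phi_n(a_m) = 0 whenever m \ne n. -/
open scoped ComplexOrder

/-- A state on a unital C*-algebra: a positive linear functional sending `1` to `1`. -/
def IsState {A : Type*} [NormedRing A] [StarRing A] [NormedAlgebra ℂ A]
    (φ : A →L[ℂ] ℂ) : Prop :=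
  φ 1 = 1 ∧ ∀ x : A, 0 ≤ φ (star x * x)

universe u

section

variable {B : Type*} [CStarAlgebra B]

/-- A contractive functional sending `1` to `1` is real on selfadjoint elements. -/
theorem im_apply_eq_zero_of_norm_le_one {g : B →L[ℂ] ℂ} (hg : ‖g‖ ≤ 1) (h1 : g 1 = 1) {h : B}
    (hh : IsSelfAdjoint h) : (g h).im = 0 := by
  have key (t : ℝ) : ‖g h - t * Complex.I‖ ^ 2 ≤ ‖h‖ ^ 2 + t ^ 2 := by
    set z : ℂ := t * Complex.I with hz
    have e : g h - z = g (h - z • 1) := by simp [h1]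
    have hzs : star z = -z := by simp [hz]
    have hzz : z * z = -(t : ℂ) ^ 2 := by
      linear_combination ((t : ℂ) ^ 2) * Complex.I_sq
    have hzz1 : z • z • (1 : B) = -((t : ℂ) ^ 2 • 1) := by
      rw [← neg_smul, ← hzz]
      exact (mul_smul z z 1).symm
    have e2 : star (h - z • (1 : B)) * (h - z • 1)
        = h * h + ((t : ℂ) ^ 2) • 1 := by
      simp only [star_sub, hh.star_eq, star_smul, star_one, hzs, sub_mul, mul_sub, smul_mul_assoc,
        one_mul, mul_smul_comm, mul_one, smul_sub, neg_smul, neg_mul, smul_neg,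
        hzz1]
      abel
    have n1 : ‖(1 : B)‖ ≤ 1 := by
      rcases subsingleton_or_nontrivial B with _ | _
      · simp [Subsingleton.elim (1 : B) 0]
      · exact CStarRing.norm_one.le
    calc ‖g h - z‖ ^ 2 ≤ ‖h - z • (1 : B)‖ ^ 2 := by
          rw [e]
          gcongr
          exact (g.le_of_opNorm_le hg _).trans_eq (one_mul _)
      _ = ‖h * h + ((t : ℂ) ^ 2) • (1 : B)‖ := by
          rw [← e2, CStarRing.norm_star_mul_self, sq]
      _ ≤ ‖h‖ * ‖h‖ + t ^ 2 * 1 := by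
          refine (norm_add_le _ _).trans (add_le_add (norm_mul_le _ _) ?_)
          rw [norm_smul]
          simp only [norm_pow, Complex.norm_real, Real.norm_eq_abs, sq_abs]
          gcongr
      _ = _ := by ring
  by_contra hne
  have k := key (-(‖h‖ ^ 2 + 1) / (g h).im)
  rw [← Complex.normSq_eq_norm_sq, Complex.normSq_apply] at k
  simp only [Complex.sub_re, Complex.mul_re, Complex.ofReal_re, Complex.I_re, mul_zero,
    Complex.ofReal_im, Complex.I_im, mul_one, sub_self, sub_zero, Complex.sub_im, Complex.mul_im,
    add_zero] at k
  have : (-(‖h‖ ^ 2 + 1) / (g h).im) * (g h).im = -(‖h‖ ^ 2 + 1) := by field_simp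
  nlinarith [sq_nonneg (g h).re, sq_nonneg (g h).im, sq_nonneg ‖h‖]

/-- A contractive functional sending `1` to `1` is a state. -/
theorem isState_of_norm_le_one [PartialOrder B] [StarOrderedRing B] {g : B →L[ℂ] ℂ}
    (hg : ‖g‖ ≤ 1) (h1 : g 1 = 1) : IsState g := by
  refine ⟨h1, fun x => ?_⟩
  have hx := star_mul_self_nonneg x
  set h := star x * x
  have hM : ‖algebraMap ℝ B ‖h‖ - h‖ ≤ ‖h‖ := by
    refine CStarAlgebra.norm_le_iff_le_algebraMap _ (norm_nonneg _) ?_ |>.2 ?_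
    · exact sub_nonneg.2 (IsSelfAdjoint.le_algebraMap_norm_self (.of_nonneg hx))
    · simpa using hx
  have e : g (algebraMap ℝ B ‖h‖ - h) = (‖h‖ : ℂ) - g h := by
    rw [map_sub, Algebra.algebraMap_eq_smul_one, ← Complex.coe_smul, map_smul, h1]
    simp
  have hn : ‖(‖h‖ : ℂ) - g h‖ ≤ ‖h‖ :=
    e ▸ (g.le_of_opNorm_le hg _).trans ((one_mul _).trans_le hM)
  have := (Complex.re_le_norm _).trans hn
  rw [Complex.nonneg_iff]
  exact ⟨by simpa using this, (im_apply_eq_zero_of_norm_le_one hg h1 (.of_nonneg hx)).symm⟩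

/-- The norm of a positive contraction of norm one is attained at a state. -/
theorem exists_isState_apply_eq_one [PartialOrder B] [StarOrderedRing B] {a : B}
    (ha0 : 0 ≤ a) (ha1 : a ≤ 1) (hn : ‖a‖ = 1) : ∃ g : B →L[ℂ] ℂ, IsState g ∧ g a = 1 := by
  have : Nontrivial B := ⟨a, 0, by rintro rfl; simp at hn⟩
  obtain ⟨g, hg, hga⟩ := exists_dual_vector ℂ a (norm_ne_zero_iff.1 (by simp [hn]))
  replace hga : g a = 1 := by simpa [hn] using hga
  have hb : ‖a + a - 1‖ ≤ 1 := by
    have hsa : IsSelfAdjoint (a + a - 1) :=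
      ((IsSelfAdjoint.of_nonneg ha0).add (.of_nonneg ha0)).sub (.one B)
    have hpos : 0 ≤ a * (1 - a) := Commute.mul_nonneg ha0 (sub_nonneg.2 ha1)
      ((Commute.one_right a).sub_right (.refl a))
    have hsq : star (a + a - 1) * (a + a - 1) =
        1 - (a * (1 - a) + a * (1 - a) + a * (1 - a) + a * (1 - a)) := by
      rw [hsa.star_eq]; noncomm_ring
    have h := CStarAlgebra.norm_le_norm_of_nonneg_of_le (star_mul_self_nonneg (a + a - 1))
      (hsq.le.trans (sub_le_self _ (by positivity)))
    rw [CStarRing.norm_star_mul_self, CStarRing.norm_one] at h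
    nlinarith [norm_nonneg (a + a - 1)]
  have hle := (g.le_of_opNorm_le hg.le _).trans ((one_mul _).trans_le hb)
  have hle1 := (g.le_of_opNorm_le hg.le 1).trans ((one_mul _).trans_le CStarRing.norm_one.le)
  rw [map_sub, map_add, hga] at hle
  refine ⟨g, isState_of_norm_le_one hg.le ?_, hga⟩
  have hre : (1 : ℝ) ≤ (g 1).re := by
    have := (Complex.re_le_norm _).trans hle
    simp at this
    linarith
  have hsq := Complex.normSq_apply (g 1)
  rw [Complex.normSq_eq_norm_sq] at hsq
  apply Complex.ext <;> simp <;> nlinarith [norm_nonneg (g 1), sq_nonneg (g 1).im]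

/-- If a finite-dimensional commutative C*-algebra contains its commutant in `B`, then `B` is
finite-dimensional. -/
theorem finiteDimensional_of_maximal_finite {X : Type*} [TopologicalSpace X] [CompactSpace X]
    [T2Space X] [Finite X] (Φ : C(X, ℂ) →⋆ₐ[ℂ] B)
    (hmax : ∀ b : B, (∀ f, Commute (Φ f) b) → ∃ g, Φ g = b) : FiniteDimensional ℂ B := by
  classical
  have := Fintype.ofFinite X
  let q (x : X) : C(X, ℂ) := ⟨Pi.single x 1, continuous_of_discreteTopology⟩
  have hfq (f : C(X, ℂ)) (x : X) : f * q x = f x • q x := by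
    ext y; by_cases h : y = x <;> simp [q, h]
  have hq_sum : ∑ x, q x = 1 := by
    ext y; simp [q, ContinuousMap.sum_apply, Pi.single_apply]
  have hq_star (x : X) : star (q x) = q x := by
    ext y; by_cases h : y = x <;> simp [q, h]
  let p (x : X) : B := Φ (q x)
  have hΦp (f : C(X, ℂ)) (x : X) : Φ f * p x = f x • p x := by
    simp only [p]; rw [← map_mul, hfq, map_smul]
  have hpΦ (f : C(X, ℂ)) (x : X) : p x * Φ f = f x • p x := by
    simp only [p]; rw [← map_mul, mul_comm, hfq, map_smul]
  have hp_sum : ∑ x, p x = 1 := by simp only [p]; rw [← map_sum, hq_sum, map_one]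
  have hp_star (x : X) : star (p x) = p x := by simp only [p]; rw [← map_star, hq_star]
  have hpp (x : X) : p x * p x = p x := (hΦp (q x) x).trans (by simp [q])
  have hcorner (x : X) (b : B) : ∃ c : ℂ, p x * b * p x = c • p x := by
    obtain ⟨g, hg⟩ := hmax (p x * b * p x) fun f => by
      rw [Commute, SemiconjBy, ← mul_assoc, ← mul_assoc, hΦp, mul_assoc _ _ (Φ f), hpΦ]
      simp
    refine ⟨g x, ?_⟩
    rw [← hΦp, hg, mul_assoc (p x * b), hpp]
  have hline (x y : X) : ∃ v : B, ∀ b, ∃ c : ℂ, p x * b * p y = c • v := by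
    by_cases h : ∀ b, p x * b * p y = 0
    · exact ⟨0, fun b => ⟨0, by simp [h b]⟩⟩
    push Not at h
    obtain ⟨b₀, hb₀⟩ := h
    refine ⟨p x * b₀ * p y, fun b => ?_⟩
    obtain ⟨l, hl⟩ := hcorner y (star b₀ * p x * b₀)
    obtain ⟨c, hc⟩ := hcorner x (b * p y * star b₀)
    have hv : star (p x * b₀ * p y) * (p x * b₀ * p y) = l • p y := by
      rw [← hl]
      simp only [star_mul, hp_star]
      calc _ = p y * star b₀ * (p x * p x) * b₀ * p y := by noncomm_ring
        _ = _ := by rw [hpp]; noncomm_ring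
    have hl0 : l ≠ 0 := by
      rintro rfl
      rw [zero_smul] at hv
      exact hb₀ (CStarRing.star_mul_self_eq_zero_iff _ |>.1 hv)
    refine ⟨l⁻¹ * c, ?_⟩
    rw [mul_smul, eq_inv_smul_iff₀ hl0]
    calc l • (p x * b * p y) = p x * b * (l • p y) := by simp
      _ = p x * b * (p y * (star b₀ * p x * b₀) * p y) := by rw [hl]
      _ = (p x * (b * p y * star b₀) * p x) * b₀ * p y := by noncomm_ring
      _ = c • (p x * b₀ * p y) := by rw [hc]; simp
  choose v hv using hline
  refine ⟨⟨Finset.univ.image fun i : X × X => v i.1 i.2, eq_top_iff.2 fun b _ => ?_⟩⟩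
  have hb : b = ∑ x, ∑ y, p x * b * p y := by
    simp_rw [← Finset.mul_sum, ← Finset.sum_mul, hp_sum, one_mul, mul_one]
  rw [hb]
  refine Submodule.sum_mem _ fun x _ => Submodule.sum_mem _ fun y _ => ?_
  obtain ⟨c, hc⟩ := hv x y b
  rw [hc]
  exact Submodule.smul_mem _ _ (Submodule.subset_span (by simp))

/-- Every unital C*-algebra has a maximal commutative C*-subalgebra, of the form `C(X, ℂ)` with `X`
compact Hausdorff. -/
theorem exists_maximal_commutative (B : Type u) [CStarAlgebra B] :
    ∃ (X : Type u) (_ : TopologicalSpace X) (_ : CompactSpace X) (_ : T2Space X)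
      (Φ : C(X, ℂ) →⋆ₐ[ℂ] B), Function.Injective Φ ∧
      ∀ b : B, (∀ f, Commute (Φ f) b) → ∃ g, Φ g = b := by
  let r : selfAdjoint B → selfAdjoint B → Prop := fun a b => Commute (a : B) b
  obtain ⟨hchain, hmaximal⟩ := maxChain_spec (r := r)
  set S := maxChain r
  have hS {a b : selfAdjoint B} (ha : a ∈ S) (hb : b ∈ S) : Commute (a : B) b := by
    rcases eq_or_ne a b with rfl | hab
    · exact .refl _
    · exact (hchain ha hb hab).elim id Commute.symm
  have hS' (a : selfAdjoint B) (ha : ∀ b ∈ S, Commute (a : B) b) : a ∈ S := by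
    rw [hmaximal (hchain.insert fun b hb _ => .inl (ha b hb)) (Set.subset_insert a S)]
    exact Set.mem_insert a S
  let C : StarSubalgebra ℂ B := StarSubalgebra.centralizer ℂ (Subtype.val '' S)
  have memC (z : B) : z ∈ C ↔ ∀ s ∈ S, Commute (s : B) z := by
    simp only [C, StarSubalgebra.mem_centralizer_iff, Set.forall_mem_image]
    exact forall₂_congr fun s _ => by rw [s.2.star_eq, and_self]; rfl
  have hre (z : B) (hz : z ∈ C) : realPart z ∈ S ∧ imaginaryPart z ∈ S := by
    have hz' := star_mem hz
    rw [memC] at hz hz'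
    refine ⟨hS' _ fun b hb => ?_, hS' _ fun b hb => ?_⟩
    · rw [realPart_apply_coe]
      exact (((hz b hb).add_right (hz' b hb)).smul_right _).symm
    · rw [imaginaryPart_apply_coe]
      exact ((((hz b hb).sub_right (hz' b hb)).smul_right _).smul_right _).symm
  have hcomm (z w : B) (hz : z ∈ C) (hw : w ∈ C) : Commute z w := by
    rw [← realPart_add_I_smul_imaginaryPart z]
    have h (a : selfAdjoint B) (ha : a ∈ S) : Commute (a : B) w := (memC w).1 hw a ha
    exact (h _ (hre z hz).1).add_left ((h _ (hre z hz).2).smul_left _)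
  have hclosed : IsClosed (C : Set B) := by
    rw [StarSubalgebra.coe_centralizer]
    exact Set.isClosed_centralizer _
  let _ : CommCStarAlgebra C :=
    { StarSubalgebra.cstarAlgebra C with
      mul_comm := fun a b => Subtype.ext (hcomm a b a.2 b.2) }
  let e := gelfandStarTransform C
  refine ⟨WeakDual.characterSpace ℂ C, inferInstance, inferInstance, inferInstance,
    C.subtype.comp (e.symm : C(WeakDual.characterSpace ℂ C, ℂ) →⋆ₐ[ℂ] C), ?_, ?_⟩
  · exact Subtype.val_injective.comp e.symm.injective
  · intro b hb
    have hbC : b ∈ C := by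
      rw [memC]
      intro s hs
      have hsC : (s : B) ∈ C := (memC _).2 fun t ht => hS ht hs
      simpa using hb (e ⟨s, hsC⟩)
    exact ⟨e ⟨b, hbC⟩, by simp⟩

/-- A C*-algebra containing `C(X, ℂ)`, with `X` infinite, contains an infinite sequence of orthogonal
positive elements of norm one. -/
theorem exists_orthogonal_of_infinite [PartialOrder B] [StarOrderedRing B]
    {X : Type*} [TopologicalSpace X] [CompactSpace X]
    [T2Space X] [Infinite X] (Φ : C(X, ℂ) →⋆ₐ[ℂ] B) (hΦ : Function.Injective Φ) :
    ∃ a : ℕ → B, (∀ m n, m ≠ n → a m * a n = 0) ∧ (∀ n, 0 ≤ a n) ∧ (∀ n, ‖a n‖ = 1) ∧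
      (∀ n, a n ≤ 1) ∧ ∀ m n, m ≠ n → a m + a n ≤ 1 := by
  obtain ⟨U, hUinf, hUo, hUd⟩ := exists_seq_infinite_isOpen_pairwise_disjoint X
  choose x hx using fun n => (hUinf n).nonempty
  choose f hf0 hf1 hf using fun n => exists_continuous_zero_one_of_isClosed
    (hUo n).isClosed_compl (isClosed_singleton (x := x n)) (by simpa using hx n)
  have hzero (m n : ℕ) (hmn : m ≠ n) (y : X) : f m y = 0 ∨ f n y = 0 := by
    by_cases hy : y ∈ U m
    · exact .inr (hf0 n (Set.disjoint_left.1 (hUd hmn) hy))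
    · exact .inl (hf0 m hy)
  let g (n : ℕ) : C(X, ℂ) := ⟨fun y => (f n y : ℂ), by fun_prop⟩
  have hg_one (n : ℕ) : g n ≤ 1 := ContinuousMap.le_def.2 fun y => by
    change (f n y : ℂ) ≤ 1
    exact_mod_cast (hf n y).2
  have hmono {u v : C(X, ℂ)} (h : u ≤ v) : Φ u ≤ Φ v := OrderHomClass.mono Φ h
  refine ⟨fun n => Φ (g n), fun m n hmn => ?_, fun n => ?_, fun n => ?_, fun n => ?_,
    fun m n hmn => ?_⟩
  · rw [← map_mul, ← map_zero Φ]
    congr 1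
    ext y
    simpa [g] using hzero m n hmn y
  · rw [← map_zero Φ]
    exact hmono (ContinuousMap.le_def.2 fun y => by simpa [g] using (hf n y).1)
  · rw [NonUnitalStarAlgHom.norm_map Φ hΦ]
    refine le_antisymm ((ContinuousMap.norm_le _ zero_le_one).2 fun y => ?_) ?_
    · simpa [g, abs_of_nonneg (hf n y).1] using (hf n y).2
    · have h := (g n).norm_coe_le_norm (x n)
      simpa [g, hf1 n rfl] using h
  · rw [← map_one Φ]
    exact hmono (hg_one n)
  · rw [← map_one Φ, ← map_add]
    refine hmono (ContinuousMap.le_def.2 fun y => ?_)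
    have hm := ContinuousMap.le_def.1 (hg_one m) y
    have hn := ContinuousMap.le_def.1 (hg_one n) y
    rcases hzero m n hmn y with h | h
    · simpa [g, h] using hn
    · simpa [g, h] using hm

end

/-- If `B` is an infinite-dimensional unital C*-algebra, then there are a sequence of
pairwise orthogonal positive contractions `aₙ` and states `φₙ` with `φₙ(aₙ) = 1` and
`φₙ(aₘ) = 0` for `m ≠ n`. -/
theorem exists_orthogonal_positives_and_states
    {B : Type*} [NormedRing B] [StarRing B] [CStarRing B] [NormedAlgebra ℂ B]
    [StarModule ℂ B] [CompleteSpace B] [PartialOrder B] [StarOrderedRing B]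
    (hB : ¬ FiniteDimensional ℂ B) :
    ∃ (a : ℕ → B) (φ : ℕ → (B →L[ℂ] ℂ)),
      (∀ m n, m ≠ n → a m * a n = 0) ∧
      (∀ n, 0 ≤ a n) ∧ (∀ n, a n ≤ 1) ∧
      (∀ n, IsState (φ n)) ∧
      (∀ n, φ n (a n) = 1) ∧
      (∀ m n, m ≠ n → φ n (a m) = 0) := by
  let _ : CStarAlgebra B := {}
  obtain ⟨X, _, _, _, Φ, hΦ, hmax⟩ := exists_maximal_commutative B
  have : Infinite X := not_finite_iff_infinite.1 fun _ =>
    hB (finiteDimensional_of_maximal_finite Φ hmax)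
  obtain ⟨a, horth, h0, hnorm, h1, hadd⟩ := exists_orthogonal_of_infinite Φ hΦ
  choose φ hφ hφa using fun n => exists_isState_apply_eq_one (h0 n) (h1 n) (hnorm n)
  have hφ_nonneg (n : ℕ) {b : B} (hb : 0 ≤ b) : 0 ≤ φ n b := by
    obtain ⟨c, rfl⟩ := CStarAlgebra.nonneg_iff_eq_star_mul_self.1 hb
    exact (hφ n).2 c
  refine ⟨a, φ, horth, h0, h1, hφ, hφa, fun m n hmn => le_antisymm ?_ (hφ_nonneg n (h0 m))⟩
  have h := hφ_nonneg n (sub_nonneg.2 (hadd m n hmn))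
  rw [map_sub, map_add, (hφ n).1, hφa] at h
  simpa using h
end

section
/- No SAW*-algebra is *-isomorphic to a C*-tensor product B \otimes_\nu C of two infinite-dimensional C*-algebras, for any C*-norm \nu on the algebraic tensor product B \odot C. -/
/-- A C*-algebra is a SAW*-algebra if for any two orthogonal positive elements `x, y`
there is a positive `e` with `e x = x` and `e y = 0`. -/
def IsSAWStar (A : Type*) [NonUnitalRing A] [PartialOrder A] : Prop :=
  ∀ x y : A, 0 ≤ x → 0 ≤ y → x * y = 0 → ∃ e : A, 0 ≤ e ∧ e * x = x ∧ e * y = 0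

section FunctionalCalculus

variable {A : Type*} [NonUnitalCStarAlgebra A] [PartialOrder A] [StarOrderedRing A]

lemma norm_mem_quasispectrum_of_nonneg {a : A} (ha : 0 ≤ a) : ‖a‖ ∈ quasispectrum ℝ a := by
  obtain ⟨x, hx, hxa⟩ := (IsGreatest.norm_cfcₙ (𝕜 := ℝ) (id : ℝ → ℝ) a).1
  rw [cfcₙ_id ℝ a] at hxa
  have h0 : 0 ≤ x := quasispectrum_nonneg_of_nonneg a ha x hx
  simp only [id, Real.norm_eq_abs, abs_of_nonneg h0] at hxa
  rwa [← hxa]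

/-- A positive element is nearly a scalar multiple of the identity under compression by a suitable
norm-one positive element. -/
lemma exists_compression_near_norm {a : A} (ha : 0 ≤ a) (ha0 : a ≠ 0) {ε : ℝ} (hε : 0 < ε) :
    ∃ s : A, 0 ≤ s ∧ ‖s‖ = 1 ∧ ‖s * a * s - ‖a‖ • (s * s)‖ ≤ ε := by
  have hM : 0 < ‖a‖ := norm_pos_iff.mpr ha0
  set M := ‖a‖ with hMa
  set δ := min ε M with hδe
  have hδ : 0 < δ := lt_min hε hM
  have hδM : δ ≤ M := min_le_right _ _
  let f : ℝ → ℝ := fun x => max 0 (1 - |x - M| / δ)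
  have hf : Continuous f := by fun_prop
  have hf0 : f 0 = 0 := by
    have : 1 ≤ M / δ := (one_le_div hδ).mpr hδM
    simp only [f, zero_sub, abs_neg, abs_of_pos hM]
    exact max_eq_left (by linarith)
  have hfn : ∀ x, 0 ≤ f x := fun x => le_max_left _ _
  have hf1 : ∀ x, f x ≤ 1 := fun x => max_le zero_le_one (by
    have : 0 ≤ |x - M| / δ := by positivity
    linarith)
  have hfM : f M = 1 := by simp [f]
  have hfd : ∀ x, f x * |x - M| ≤ δ := by
    intro x
    by_cases h : |x - M| ≤ δ
    · nlinarith [hf1 x, hfn x, abs_nonneg (x - M)]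
    · have : f x = 0 := by
        have : 1 ≤ |x - M| / δ := (one_le_div hδ).mpr (not_le.mp h).le
        exact max_eq_left (by linarith)
      rw [this]; linarith
  clear_value f M δ
  refine ⟨cfcₙ f a, cfcₙ_nonneg fun x _ => hfn x, ?_, ?_⟩
  · apply le_antisymm
    · exact norm_cfcₙ_le fun x _ => by simpa [abs_of_nonneg (hfn x)] using hf1 x
    · have := norm_apply_le_norm_cfcₙ f a (norm_mem_quasispectrum_of_nonneg ha)
      rwa [← hMa, hfM, norm_one] at this
  · have key : cfcₙ f a * a * cfcₙ f a - M • (cfcₙ f a * cfcₙ f a)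
        = cfcₙ (fun x => f x * x * f x - M • (f x * f x)) a := by
      rw [cfcₙ_sub (fun x => f x * x * f x) (fun x => M • (f x * f x)) a,
        cfcₙ_smul M (fun x => f x * f x) a, cfcₙ_mul f f a, cfcₙ_mul (fun x => f x * x) f a,
        cfcₙ_mul f (fun x => x) a, cfcₙ_id' ℝ a]
    rw [key]
    refine norm_cfcₙ_le fun x _ => ?_
    have : f x * x * f x - M • (f x * f x) = f x * (f x * (x - M)) := by simp; ring
    rw [this, norm_mul, norm_mul, Real.norm_eq_abs, Real.norm_eq_abs, abs_of_nonneg (hfn x)]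
    have h1 := hfd x
    have h2 : δ ≤ ε := hδe ▸ min_le_left _ _
    nlinarith [hfn x, hf1 x, mul_nonneg (hfn x) (abs_nonneg (x - M))]

lemma exists_approx_eigenvector {a : A} (ha : 0 ≤ a) (ha1 : ‖a‖ = 1) {ε : ℝ} (hε : 0 < ε)
    (hε2 : ε ≤ 1 / 2) : ∃ h w : A, h ≠ 0 ∧ ‖w‖ ≤ ε ∧ a * h = h + w * h := by
  let f : ℝ → ℝ := fun x => max 0 (x - (1 - ε))
  let k : ℝ → ℝ := fun x => -(min (min (1 - x) ε) x)
  have hf0 : f 0 = 0 := max_eq_left (by linarith)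
  have hk0 : k 0 = 0 := by simp [k, hε.le]
  have hf : Continuous f := by fun_prop
  have hk : Continuous k := by fun_prop
  have hspec : ∀ x ∈ quasispectrum ℝ a, 0 ≤ x ∧ x ≤ 1 := fun x hx =>
    ⟨quasispectrum_nonneg_of_nonneg a ha x hx,
      (le_abs_self x).trans (ha1 ▸ NonUnitalIsometricContinuousFunctionalCalculus.norm_quasispectrum_le (𝕜 := ℝ) a hx)⟩
  refine ⟨cfcₙ f a, cfcₙ k a, ?_, ?_, ?_⟩
  · have := norm_apply_le_norm_cfcₙ f a (norm_mem_quasispectrum_of_nonneg ha)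
    rw [ha1, show f 1 = ε by simp [f, hε.le], Real.norm_eq_abs, abs_of_pos hε] at this
    exact norm_pos_iff.mp (hε.trans_le this)
  · refine norm_cfcₙ_le fun x hx => ?_
    obtain ⟨h0, h1⟩ := hspec x hx
    simp only [k, norm_neg, Real.norm_eq_abs]
    rw [abs_of_nonneg (le_min (le_min (by linarith) hε.le) h0)]
    exact (min_le_left _ _).trans (min_le_right _ _)
  · have e1 : a * cfcₙ f a = cfcₙ (fun x => x * f x) a := by
      rw [cfcₙ_mul (fun x => x) f a, cfcₙ_id' ℝ a]
    rw [e1, ← cfcₙ_mul k f a, ← cfcₙ_add f (fun x => k x * f x) a]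
    refine cfcₙ_congr fun x hx => ?_
    obtain ⟨h0, h1⟩ := hspec x hx
    by_cases h : x ≤ 1 - ε
    · have : f x = 0 := max_eq_left (by linarith)
      simp [this]
    · have : k x = -(1 - x) := by
        simp only [k]
        rw [min_eq_left (a := 1 - x) (by linarith), min_eq_left (by linarith)]
      simp only [this]; ring

end FunctionalCalculus

section OrthogonalSequences

variable {A : Type*} [NonUnitalCStarAlgebra A]

/-- The existence of a sequence of nonzero, pairwise orthogonal self-adjoint elements. -/
def HasOrthogonalSequence (A : Type*) [NonUnitalNonAssocRing A] [StarRing A] : Prop :=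
  ∃ u : ℕ → A, (∀ n, IsSelfAdjoint (u n)) ∧ (∀ n, u n ≠ 0) ∧ ∀ m n, m ≠ n → u m * u n = 0

lemma hasOrthogonalSequence_of_lt {u : ℕ → A} (hsa : ∀ n, IsSelfAdjoint (u n))
    (hne : ∀ n, u n ≠ 0) (h : ∀ m n, m < n → u m * u n = 0) : HasOrthogonalSequence A := by
  refine ⟨u, hsa, hne, fun m n hmn => ?_⟩
  rcases hmn.lt_or_gt with hlt | hlt
  · exact h m n hlt
  · have := congrArg star (h n m hlt)
    rwa [star_mul, star_zero, (hsa m).star_eq, (hsa n).star_eq] at this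

lemma hasOrthogonalSequence_of_infinite_quasispectrum {a : A} (ha : IsSelfAdjoint a)
    (hinf : (quasispectrum ℝ a).Infinite) : HasOrthogonalSequence A := by
  set σ := quasispectrum ℝ a with hσ
  have : Infinite ↥(σ \ {0}) := (hinf.sdiff (Set.finite_singleton 0)).to_subtype
  obtain ⟨U, hUinf, hUo, hUd⟩ := exists_seq_infinite_isOpen_pairwise_disjoint ↥(σ \ {0})
  let K : ℕ → Set ℝ := fun n => σ \ (Subtype.val '' U n)
  have h0K : ∀ n, (0 : ℝ) ∈ K n := fun n =>
    ⟨quasispectrum.zero_mem ℝ a, by rintro ⟨⟨x, hx⟩, -, rfl⟩; exact hx.2 rfl⟩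
  let f : ℕ → ℝ → ℝ := fun n x => Metric.infDist x (K n)
  have hf : ∀ n, Continuous (f n) := fun n => Metric.continuous_infDist_pt _
  have hfK : ∀ n x, x ∈ K n → f n x = 0 := fun n x hx => Metric.infDist_zero_of_mem hx
  have hf0 : ∀ n, f n 0 = 0 := fun n => hfK n 0 (h0K n)
  have hpos : ∀ n, ∃ x ∈ σ, f n x ≠ 0 := by
    intro n
    obtain ⟨⟨x, hx⟩, hxU⟩ := (hUinf n).nonempty
    refine ⟨x, hx.1, fun h => ?_⟩
    have hcl : x ∈ closure (K n) := (Metric.mem_closure_iff_infDist_zero ⟨0, h0K n⟩).mpr h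
    obtain ⟨V, hVo, hVU⟩ := isOpen_induced_iff.mp (hUo n)
    have hxV : x ∈ V \ {0} := by
      refine ⟨?_, hx.2⟩
      have : (⟨x, hx⟩ : ↥(σ \ {0})) ∈ Subtype.val ⁻¹' V := hVU ▸ hxU
      exact this
    obtain ⟨y, hyV, hyK⟩ := mem_closure_iff.mp hcl _ (hVo.sdiff isClosed_singleton) hxV
    have hy : y ∈ σ \ {0} := ⟨hyK.1, hyV.2⟩
    apply hyK.2
    refine ⟨⟨y, hy⟩, ?_, rfl⟩
    rw [← hVU]
    exact hyV.1
  have hmul : ∀ m n, m ≠ n → ∀ x ∈ σ, f m x * f n x = 0 := by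
    intro m n hmn x hx
    by_cases hm : x ∈ K m
    · rw [hfK m x hm, zero_mul]
    · rw [hfK n x, mul_zero]
      refine ⟨hx, ?_⟩
      rintro ⟨y, hyn, rfl⟩
      apply hm
      refine ⟨hx, ?_⟩
      rintro ⟨z, hzm, hzy⟩
      obtain rfl := Subtype.ext hzy
      exact Set.disjoint_left.mp (hUd hmn) hzm hyn
  clear_value f
  refine ⟨fun n => cfcₙ (f n) a, fun n => cfcₙ_predicate _ _, fun n h => ?_, fun m n hmn => ?_⟩
  · obtain ⟨x, hx, hxn⟩ := hpos n
    have := norm_apply_le_norm_cfcₙ (f n) a hx (hf n).continuousOn (hf0 n) ha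
    rw [show cfcₙ (f n) a = 0 from h, norm_zero] at this
    exact hxn (norm_le_zero_iff.mp this)
  · change cfcₙ (f m) a * cfcₙ (f n) a = 0
    rw [← cfcₙ_mul (f m) (f n) a (hf m).continuousOn (hf0 m) (hf n).continuousOn (hf0 n),
      cfcₙ_congr (g := fun _ => 0) (fun x hx => hmul m n hmn x hx), cfcₙ_const_zero]

/-- A nonzero self-adjoint element of finite spectrum has a nonzero spectral projection. -/
lemma exists_spectral_projection {a : A} (ha : IsSelfAdjoint a) (ha0 : a ≠ 0)
    (hfin : (quasispectrum ℝ a).Finite) :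
    ∃ (p y : A) (r : ℂ), IsStarProjection p ∧ p ≠ 0 ∧ p = a * y ∧ p = y * a ∧ a * p = r • p := by
  have hex : ∃ r ∈ quasispectrum ℝ a, r ≠ 0 := by
    by_contra! h
    exact ha0 (CFC.eq_zero_of_quasispectrum_eq_zero (R := ℝ) a (fun x hx => h x hx) ha)
  obtain ⟨r, hr, hr0⟩ := hex
  let f : ℝ → ℝ := fun x => if x = r then 1 else 0
  have hf : ContinuousOn f (quasispectrum ℝ a) := hfin.continuousOn f
  have hf0 : f 0 = 0 := by simp [f, hr0.symm]
  have hff : ∀ x, f x * f x = f x := fun x => by by_cases h : x = r <;> simp [f, h]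
  have hxf : ∀ x, x * f x = r * f x := fun x => by by_cases h : x = r <;> simp [f, h]
  have hfr : f r = 1 := by simp [f]
  clear_value f
  have hap : a * cfcₙ f a = r • cfcₙ f a := by
    have : a * cfcₙ f a = cfcₙ (fun x => x * f x) a := by
      rw [cfcₙ_mul (fun x => x) f a, cfcₙ_id' ℝ a]
    rw [this, ← cfcₙ_smul r f a]
    exact cfcₙ_congr fun x _ => by simpa using hxf x
  have hcomm : cfcₙ f a * a = a * cfcₙ f a := by
    have := cfcₙ_commute_cfcₙ f (fun x : ℝ => x) a
    rwa [cfcₙ_id' ℝ a] at this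
  refine ⟨cfcₙ f a, r⁻¹ • cfcₙ f a, (r : ℂ), ⟨?_, cfcₙ_predicate _ _⟩, fun h => ?_, ?_, ?_, ?_⟩
  · change cfcₙ f a * cfcₙ f a = cfcₙ f a
    rw [← cfcₙ_mul f f a]
    exact cfcₙ_congr fun x _ => hff x
  · have := norm_apply_le_norm_cfcₙ f a hr
    rw [h, hfr] at this
    norm_num at this
  · rw [mul_smul_comm, hap, inv_smul_smul₀ hr0]
  · rw [smul_mul_assoc, hcomm, hap, inv_smul_smul₀ hr0]
  · rw [hap]; exact (Complex.coe_smul r _).symm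

/-- The strict order on projections. -/
def ProjLT (q p : {p : A // IsStarProjection p}) : Prop := q ≠ p ∧ q.1 * p.1 = q.1

lemma mul_eq_of_mul_eq_right {p q : A} (hp : IsSelfAdjoint p) (hq : IsSelfAdjoint q)
    (h : q * p = q) : p * q = q := by
  simpa [hp.star_eq, hq.star_eq] using congrArg star h

lemma wellFounded_projLT (hA : ¬ HasOrthogonalSequence A) : WellFounded (ProjLT (A := A)) := by
  rw [wellFounded_iff_isEmpty_descending_chain]
  refine ⟨fun ⟨p, hp⟩ => hA ?_⟩
  have hle : ∀ m n, m ≤ n → (p n).1 * (p m).1 = (p n).1 := by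
    intro m n hmn
    induction n, hmn using Nat.le_induction with
    | base => exact (p m).2.isIdempotentElem
    | succ n _ ih => rw [← (hp n).2, mul_assoc, ih]
  have hle' : ∀ m n, m ≤ n → (p m).1 * (p n).1 = (p n).1 := fun m n hmn =>
    mul_eq_of_mul_eq_right (p m).2.isSelfAdjoint (p n).2.isSelfAdjoint (hle m n hmn)
  refine hasOrthogonalSequence_of_lt (u := fun n => (p n).1 - (p (n + 1)).1)
    (fun n => (p n).2.isSelfAdjoint.sub (p (n + 1)).2.isSelfAdjoint)
    (fun n h => (hp n).1 (Subtype.ext (sub_eq_zero.mp h).symm)) fun m n hmn => ?_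
  simp only [sub_mul, mul_sub]
  rw [hle' m n hmn.le, hle' m (n + 1) (by omega), hle' (m + 1) n hmn,
    hle' (m + 1) (n + 1) (by omega)]
  simp

lemma wellFounded_flip_projLT (hA : ¬ HasOrthogonalSequence A) :
    WellFounded (flip (ProjLT (A := A))) := by
  rw [wellFounded_iff_isEmpty_descending_chain]
  refine ⟨fun ⟨p, hp⟩ => hA ?_⟩
  have hle : ∀ m n, m ≤ n → (p m).1 * (p n).1 = (p m).1 := by
    intro m n hmn
    induction n, hmn using Nat.le_induction with
    | base => exact (p m).2.isIdempotentElem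
    | succ n _ ih => rw [← ih, mul_assoc, (hp n).2]
  have hle' : ∀ m n, m ≤ n → (p n).1 * (p m).1 = (p m).1 := fun m n hmn =>
    mul_eq_of_mul_eq_right (p n).2.isSelfAdjoint (p m).2.isSelfAdjoint (hle m n hmn)
  refine hasOrthogonalSequence_of_lt (u := fun n => (p (n + 1)).1 - (p n).1)
    (fun n => (p (n + 1)).2.isSelfAdjoint.sub (p n).2.isSelfAdjoint)
    (fun n h => (hp n).1 (Subtype.ext (sub_eq_zero.mp h).symm)) fun m n hmn => ?_
  simp only [sub_mul, mul_sub]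
  rw [hle m n hmn.le, hle m (n + 1) (by omega), hle (m + 1) n hmn,
    hle (m + 1) (n + 1) (by omega)]
  simp

/-- A nonzero projection dominates a nonzero projection `q` with `qAq = ℂq`. -/
lemma exists_minimal_projection (hA : ¬ HasOrthogonalSequence A) {p : A}
    (hp : IsStarProjection p) (hp0 : p ≠ 0) :
    ∃ q : A, IsStarProjection q ∧ q ≠ 0 ∧ q * p = q ∧ p * q = q ∧
      ∀ x : A, ∃ r : ℂ, q * x * q = r • q := by
  obtain ⟨q, ⟨hq0, hqp⟩, hmin⟩ := (wellFounded_projLT hA).has_min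
    {q | q.1 ≠ 0 ∧ q.1 * p = q.1} ⟨⟨p, hp⟩, hp0, hp.isIdempotentElem⟩
  obtain ⟨q, hq⟩ := q
  have hqq : q * q = q := hq.isIdempotentElem
  have hsa : ∀ x : A, IsSelfAdjoint x → ∃ r : ℂ, q * x * q = r • q := by
    intro x hx
    by_cases hy0 : q * x * q = 0
    · exact ⟨0, by simp [hy0]⟩
    have hy : IsSelfAdjoint (q * x * q) := by
      simp [isSelfAdjoint_iff, hx.star_eq, hq.isSelfAdjoint.star_eq, mul_assoc]
    have hfin : (quasispectrum ℝ (q * x * q)).Finite := by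
      by_contra h
      exact hA (hasOrthogonalSequence_of_infinite_quasispectrum hy h)
    obtain ⟨e, y, r, he, he0, hey, hye, hre⟩ := exists_spectral_projection hy hy0 hfin
    have heq : e * q = e := by rw [hye]; simp only [mul_assoc, hqq]
    have : e = q := by
      by_contra hne
      refine hmin ⟨e, he⟩ ⟨he0, ?_⟩ ⟨fun h => hne (congrArg Subtype.val h), heq⟩
      change e * p = e
      rw [← heq, mul_assoc, show q * p = q from hqp]
    refine ⟨r, ?_⟩
    rw [this] at hre
    simpa only [mul_assoc, hqq] using hre
  refine ⟨q, hq, hq0, hqp, mul_eq_of_mul_eq_right hp.isSelfAdjoint hq.isSelfAdjoint hqp,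
    fun x => ?_⟩
  obtain ⟨r, hr⟩ := hsa _ (realPart x).2
  obtain ⟨t, ht⟩ := hsa _ (imaginaryPart x).2
  refine ⟨r + Complex.I * t, ?_⟩
  conv_lhs => rw [← realPart_add_I_smul_imaginaryPart x]
  rw [mul_add, add_mul, hr, mul_smul_comm, smul_mul_assoc, ht, add_smul, mul_smul]

/-- Two-sided compression `x ↦ p x q`. -/
noncomputable def compression (p q : A) : A →ₗ[ℂ] A :=
  LinearMap.mulLeft ℂ p ∘ₗ LinearMap.mulRight ℂ q

lemma compression_apply (p q x : A) : compression p q x = p * (x * q) := rfl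

lemma finiteDimensional_corner_add {p q : A} (hp : IsStarProjection p) (hq : IsStarProjection q)
    (hfin : FiniteDimensional ℂ (LinearMap.range (compression p p)))
    (hmin : ∀ x : A, ∃ r : ℂ, q * x * q = r • q) :
    FiniteDimensional ℂ (LinearMap.range (compression (p + q) (p + q))) := by
  have hpp : p * p = p := hp.isIdempotentElem
  have hqq : q * q = q := hq.isIdempotentElem
  have hps : star p = p := hp.isSelfAdjoint
  have hqs : star q = q := hq.isSelfAdjoint
  have h22 : FiniteDimensional ℂ (LinearMap.range (compression q q)) := by
    refine Submodule.finiteDimensional_of_le (S₂ := Submodule.span ℂ {q}) ?_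
    rintro _ ⟨x, rfl⟩
    obtain ⟨r, hr⟩ := hmin x
    rw [compression_apply, ← mul_assoc, hr]
    exact Submodule.smul_mem _ _ (Submodule.mem_span_singleton_self q)
  have h12 : FiniteDimensional ℂ (LinearMap.range (compression p q)) ∧
      FiniteDimensional ℂ (LinearMap.range (compression q p)) := by
    by_cases h : ∀ x, p * x * q = 0
    · have e1 : compression p q = 0 := LinearMap.ext fun x => by
        rw [compression_apply, ← mul_assoc, h]; rfl
      have e2 : compression q p = 0 := LinearMap.ext fun x => by
        have := congrArg star (h (star x))
        simp only [star_mul, star_star, hps, hqs, star_zero] at this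
        rw [compression_apply, this]; rfl
      rw [e1, e2, LinearMap.range_zero]
      exact ⟨inferInstance, inferInstance⟩
    · push Not at h
      obtain ⟨x, hx⟩ := h
      set w := p * x * q with hw
      obtain ⟨r, hr⟩ := hmin (star x * p * x)
      have hww : star w * w = r • q := by
        rw [← hr, hw]
        simp only [star_mul, hps, hqs, mul_assoc]
        rw [← mul_assoc p p, hpp]
      have hr0 : r ≠ 0 := by
        rintro rfl
        rw [zero_smul] at hww
        exact hx (CStarRing.star_mul_self_eq_zero_iff w |>.mp hww)
      constructor
      · refine Submodule.finiteDimensional_of_le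
          (S₂ := (LinearMap.range (compression p p)).map (LinearMap.mulRight ℂ w)) ?_
        rintro _ ⟨y, rfl⟩
        refine ⟨_, ⟨r⁻¹ • (y * q * star x), rfl⟩, ?_⟩
        have : p * (y * q) = r⁻¹ • (p * (y * q) * (star w * w)) := by
          rw [hww, mul_smul_comm, inv_smul_smul₀ hr0]
          simp only [mul_assoc, hqq]
        rw [compression_apply, compression_apply, this, LinearMap.mulRight_apply, hw]
        simp only [star_mul, hps, hqs, mul_assoc, smul_mul_assoc, mul_smul_comm]
        rw [← mul_assoc q q, hqq]
      · refine Submodule.finiteDimensional_of_le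
          (S₂ := (LinearMap.range (compression p p)).map (LinearMap.mulLeft ℂ (star w))) ?_
        rintro _ ⟨y, rfl⟩
        refine ⟨_, ⟨r⁻¹ • (x * q * y), rfl⟩, ?_⟩
        have : q * (y * p) = r⁻¹ • ((star w * w) * (q * (y * p))) := by
          rw [hww, smul_mul_assoc, inv_smul_smul₀ hr0, ← mul_assoc q q, hqq]
        rw [compression_apply, compression_apply, this, LinearMap.mulLeft_apply, hw]
        simp only [star_mul, hps, hqs, mul_assoc, smul_mul_assoc, mul_smul_comm]
        rw [← mul_assoc q q (y * p), hqq]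
  have := h12.1
  have := h12.2
  refine Submodule.finiteDimensional_of_le (S₂ := (LinearMap.range (compression p p) ⊔
    LinearMap.range (compression p q)) ⊔ (LinearMap.range (compression q p) ⊔
    LinearMap.range (compression q q))) ?_
  rintro _ ⟨x, rfl⟩
  have : compression (p + q) (p + q) x = (compression p p x + compression p q x) +
      (compression q p x + compression q q x) := by
    simp only [compression_apply, mul_add, add_mul]; abel
  rw [this]
  exact Submodule.add_mem_sup
    (Submodule.add_mem_sup ⟨x, rfl⟩ ⟨x, rfl⟩) (Submodule.add_mem_sup ⟨x, rfl⟩ ⟨x, rfl⟩)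

/-- Every infinite-dimensional C⋆-algebra contains a sequence of nonzero, pairwise orthogonal
self-adjoint elements. -/
theorem hasOrthogonalSequence_of_not_finiteDimensional (h : ¬ FiniteDimensional ℂ A) :
    HasOrthogonalSequence A := by
  by_contra hA
  obtain ⟨⟨p, hp⟩, hfin, hmax⟩ := (wellFounded_flip_projLT hA).has_min
    {p | FiniteDimensional ℂ (LinearMap.range (compression p.1 p.1))} ⟨⟨0, .zero A⟩, by
      have : compression (0 : A) 0 = 0 := LinearMap.ext fun x => by simp [compression_apply]
      change FiniteDimensional ℂ (LinearMap.range (compression (0 : A) 0))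
      rw [this, LinearMap.range_zero]
      infer_instance⟩
  have hpp : p * p = p := hp.isIdempotentElem
  have hps : star p = p := hp.isSelfAdjoint
  have hright : ∀ x, x * p = x := by
    by_contra! hx
    obtain ⟨x, hx⟩ := hx
    set z := x - x * p with hz
    have hz0 : z ≠ 0 := fun h => hx (sub_eq_zero.mp h).symm
    have hzp : z * p = 0 := by rw [hz, sub_mul, mul_assoc, hpp, sub_self]
    have hpz : p * star z = 0 := by simpa [hps] using congrArg star hzp
    have ha0 : star z * z ≠ 0 := fun h => hz0 (CStarRing.star_mul_self_eq_zero_iff z |>.mp h)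
    have hafin : (quasispectrum ℝ (star z * z)).Finite := by
      by_contra h
      exact hA (hasOrthogonalSequence_of_infinite_quasispectrum (.star_mul_self z) h)
    obtain ⟨e, y, r, he, he0, hey, hye, -⟩ :=
      exists_spectral_projection (.star_mul_self z) ha0 hafin
    have hpe : p * e = 0 := by rw [hey, ← mul_assoc, ← mul_assoc, hpz, zero_mul, zero_mul]
    obtain ⟨q, hq, hq0, hqe, heq, hmin⟩ := exists_minimal_projection hA he he0
    have hpq : p * q = 0 := by rw [← heq, ← mul_assoc, hpe, zero_mul]
    refine hmax ⟨p + q, hp.add hq hpq⟩ (finiteDimensional_corner_add hp hq hfin hmin)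
      ⟨fun h => hq0 ?_, ?_⟩
    · simpa using congrArg Subtype.val h
    · change p * (p + q) = p
      rw [mul_add, hpp, hpq, add_zero]
  have hleft : ∀ x, p * x = x := fun x => by
    simpa [hps] using congrArg star (hright (star x))
  have htop : LinearMap.range (compression p p) = ⊤ := by
    rw [eq_top_iff]
    exact fun x _ => ⟨x, by rw [compression_apply, hright, hleft]⟩
  have : FiniteDimensional ℂ (LinearMap.range (compression p p)) := hfin
  rw [htop] at this
  exact h (LinearEquiv.finiteDimensional (Submodule.topEquiv (R := ℂ) (M := A)))

end OrthogonalSequences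

section CrossNorm

variable {B C D : Type*} [NonUnitalCStarAlgebra B] [PartialOrder B] [StarOrderedRing B]
  [NonUnitalCStarAlgebra C] [PartialOrder C] [StarOrderedRing C] [NonUnitalCStarAlgebra D]

lemma one_le_norm_map_mul_map (f : B →⋆ₙₐ[ℂ] D) (g : C →⋆ₙₐ[ℂ] D)
    (hcomm : ∀ b c, Commute (f b) (g c)) (hinj : ∀ b c, f b * g c = 0 → b = 0 ∨ c = 0)
    {b : B} {c : C} (hb : 0 ≤ b) (hb1 : ‖b‖ = 1) (hc : 0 ≤ c) (hc1 : ‖c‖ = 1) :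
    1 ≤ ‖f b * g c‖ := by
  have key : ∀ ε : ℝ, 0 < ε → ε ≤ 1 / 2 → 1 ≤ ‖f b * g c‖ + 3 * ε := by
    intro ε hε hε2
    obtain ⟨h, w, hh, hw, hbh⟩ := exists_approx_eigenvector hb hb1 hε hε2
    obtain ⟨k, w', hk, hw', hck⟩ := exists_approx_eigenvector hc hc1 hε hε2
    set X := f h * g k with hX
    have hX0 : 0 < ‖X‖ := norm_pos_iff.mpr fun h0 => (hinj _ _ h0).elim hh hk
    have hfb : f b * f h = f h + f w * f h := by rw [← map_mul, hbh, map_add, map_mul]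
    have hgc : g c * g k = g k + g w' * g k := by rw [← map_mul, hck, map_add, map_mul]
    have hbc : f b * g c * X = X + f w * X + g w' * X + f w * (g w' * X) := by
      calc f b * g c * X = f b * ((g c * f h) * g k) := by simp only [hX, mul_assoc]
        _ = (f b * f h) * (g c * g k) := by rw [← (hcomm h c).eq]; simp only [mul_assoc]
        _ = X + f w * X + (f h * g w') * g k + f w * ((f h * g w') * g k) := by
            rw [hfb, hgc]; simp only [hX, mul_add, add_mul, mul_assoc]; abel
        _ = _ := by rw [(hcomm h w').eq]; simp only [hX, mul_assoc]
    have hfw : ‖f w‖ ≤ ε := (NonUnitalStarAlgHom.norm_apply_le f w).trans hw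
    have hgw : ‖g w'‖ ≤ ε := (NonUnitalStarAlgHom.norm_apply_le g w').trans hw'
    have h1 : ‖f w * X‖ ≤ ε * ‖X‖ := (norm_mul_le _ _).trans (by gcongr)
    have h2 : ‖g w' * X‖ ≤ ε * ‖X‖ := (norm_mul_le _ _).trans (by gcongr)
    have h3 : ‖f w * (g w' * X)‖ ≤ ε * (ε * ‖X‖) :=
      (norm_mul_le _ _).trans (mul_le_mul hfw h2 (norm_nonneg _) hε.le)
    have h4 : ‖X‖ ≤ ‖f b * g c * X‖ + ‖f w * X‖ + ‖g w' * X‖ + ‖f w * (g w' * X)‖ := by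
      have : X = f b * g c * X - f w * X - g w' * X - f w * (g w' * X) := by rw [hbc]; abel
      calc ‖X‖ = ‖f b * g c * X - f w * X - g w' * X - f w * (g w' * X)‖ := by rw [← this]
        _ ≤ _ := (norm_sub_le _ _).trans (by
          gcongr; exact (norm_sub_le _ _).trans (by gcongr; exact norm_sub_le _ _))
    have h5 : ‖f b * g c * X‖ ≤ ‖f b * g c‖ * ‖X‖ := norm_mul_le _ _
    have h6 : ε * (ε * ‖X‖) ≤ ε * ‖X‖ := by
      apply mul_le_mul_of_nonneg_left _ hε.le
      nlinarith
    have : 1 * ‖X‖ ≤ (‖f b * g c‖ + 3 * ε) * ‖X‖ := by linarith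
    exact le_of_mul_le_mul_right this hX0
  refine le_of_forall_pos_le_add fun δ hδ => ?_
  have h1 := key (min (1/2) (δ/3)) (by positivity) (min_le_left _ _)
  have h2 := min_le_right (1/2 : ℝ) (δ/3)
  linarith

/-- A C⋆-norm on an algebraic tensor product dominates the product of norms on elementary
tensors. -/
lemma norm_mul_norm_le (f : B →⋆ₙₐ[ℂ] D) (g : C →⋆ₙₐ[ℂ] D)
    (hcomm : ∀ b c, Commute (f b) (g c)) (hinj : ∀ b c, f b * g c = 0 → b = 0 ∨ c = 0)
    (b : B) (c : C) : ‖b‖ * ‖c‖ ≤ ‖f b * g c‖ := by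
  rcases eq_or_ne b 0 with rfl | hb
  · simp
  rcases eq_or_ne c 0 with rfl | hc
  · simp
  have hb0 : 0 < ‖b‖ := norm_pos_iff.mpr hb
  have hc0 : 0 < ‖c‖ := norm_pos_iff.mpr hc
  set x : B := ((‖b‖ : ℂ)⁻¹) • b with hx
  set y : C := ((‖c‖ : ℂ)⁻¹) • c with hy
  have hx1 : ‖x‖ = 1 := by simp [hx, norm_smul, hb0.ne']
  have hy1 : ‖y‖ = 1 := by simp [hy, norm_smul, hc0.ne']
  have h1 : 1 ≤ ‖f (star x * x) * g (star y * y)‖ :=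
    one_le_norm_map_mul_map f g hcomm hinj (star_mul_self_nonneg x)
      (by rw [CStarRing.norm_star_mul_self, hx1, one_mul]) (star_mul_self_nonneg y)
      (by rw [CStarRing.norm_star_mul_self, hy1, one_mul])
  have h2 : f (star x * x) * g (star y * y) = star (f x * g y) * (f x * g y) := by
    calc f (star x * x) * g (star y * y) = star (f x) * (f x * g (star y)) * g y := by
          simp only [map_mul, map_star, mul_assoc]
      _ = star (f x) * g (star y) * (f x * g y) := by
          rw [(hcomm x (star y)).eq]; simp only [mul_assoc]
      _ = star (f x * g y) * (f x * g y) := by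
          rw [← map_star f, (hcomm (star x) (star y)).eq, star_mul, map_star, map_star]
  rw [h2, CStarRing.norm_star_mul_self] at h1
  have h3 : 1 ≤ ‖f x * g y‖ := by nlinarith [norm_nonneg (f x * g y)]
  have h4 : f b * g c = ((‖b‖ : ℂ) * ‖c‖) • (f x * g y) := by
    rw [hx, hy, map_smul, map_smul, smul_mul_smul_comm, smul_smul]
    rw [mul_mul_mul_comm, mul_inv_cancel₀, mul_inv_cancel₀, one_mul, one_smul]
    · exact_mod_cast hc0.ne'
    · exact_mod_cast hb0.ne'
  rw [h4, norm_smul, norm_mul, Complex.norm_real, Complex.norm_real, norm_norm, norm_norm]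
  exact le_mul_of_one_le_right (by positivity) h3

end CrossNorm

section RowColumn

variable {D : Type*} [NonUnitalCStarAlgebra D] [PartialOrder D] [StarOrderedRing D]

open scoped WithCStarModule

/-- Combining contractions along a commuting column of norm at most one. -/
lemma norm_mul_sq_add_mul_sq_le {p₁ p₂ ξ η : D} (hp₁ : ‖p₁‖ ≤ 1) (hp₂ : ‖p₂‖ ≤ 1)
    (hξ : IsSelfAdjoint ξ) (hη : IsSelfAdjoint η) (hc₁ : Commute p₁ ξ) (hc₂ : Commute p₂ η)
    (hle : ‖ξ * ξ + η * η‖ ≤ 1) : ‖p₁ * (ξ * ξ) + p₂ * (η * η)‖ ≤ 1 := by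
  let X : C⋆ᵐᵒᵈ(D, D × D) := (WithCStarModule.equiv D (D × D)).symm (p₁ * ξ, p₂ * η)
  let Y : C⋆ᵐᵒᵈ(D, D × D) := (WithCStarModule.equiv D (D × D)).symm (ξ, η)
  have h := CStarModule.norm_inner_le (A := D) (C⋆ᵐᵒᵈ(D, D × D)) (x := Y) (y := X)
  have hYX : inner D Y X = p₁ * (ξ * ξ) + p₂ * (η * η) := by
    change p₁ * ξ * star ξ + p₂ * η * star η = _
    rw [hξ.star_eq, hη.star_eq, mul_assoc, mul_assoc]
  have hY : ‖Y‖ ^ 2 ≤ 1 := by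
    rw [WithCStarModule.prod_norm_sq]
    change ‖ξ * star ξ + η * star η‖ ≤ 1
    rwa [hξ.star_eq, hη.star_eq]
  have hbound : ∀ {p ζ : D}, ‖p‖ ≤ 1 → IsSelfAdjoint ζ → Commute p ζ →
      p * ζ * star (p * ζ) ≤ ζ * ζ := by
    intro p ζ hp hζ hc
    calc p * ζ * star (p * ζ) = ζ * (p * star p) * star ζ := by
          rw [hc.eq, star_mul]; simp only [mul_assoc]
      _ ≤ ‖p * star p‖ • (ζ * star ζ) := CStarAlgebra.star_right_conjugate_le_norm_smul
      _ ≤ (1 : ℝ) • (ζ * star ζ) := by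
          apply smul_le_smul_of_nonneg_right _ (mul_star_self_nonneg ζ)
          rw [CStarRing.norm_self_mul_star]
          nlinarith [norm_nonneg p]
      _ = ζ * ζ := by rw [one_smul, hζ.star_eq]
  have hX : ‖X‖ ^ 2 ≤ 1 := by
    rw [WithCStarModule.prod_norm_sq]
    refine le_trans (CStarAlgebra.norm_le_norm_of_nonneg_of_le ?_ ?_) hle
    · exact add_nonneg (mul_star_self_nonneg (p₁ * ξ)) (mul_star_self_nonneg (p₂ * η))
    · exact add_le_add (hbound hp₁ hξ hc₁) (hbound hp₂ hη hc₂)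
  rw [hYX] at h
  refine h.trans ?_
  have hX' : ‖X‖ ≤ 1 := (sq_le_one_iff₀ (norm_nonneg _)).mp hX
  have hY' : ‖Y‖ ≤ 1 := (sq_le_one_iff₀ (norm_nonneg _)).mp hY
  exact mul_le_one₀ hY' (norm_nonneg _) hX'

end RowColumn

section PureFunctionals

variable {B : Type*} [NormedAddCommGroup B] [NormedSpace ℂ B]

/-- A contractive functional attaining the value one at `b₀` and admitting only trivial
norm-additive decompositions. -/
structure IsPureAt (φ : StrongDual ℂ B) (b₀ : B) : Prop where
  norm_le : ‖φ‖ ≤ 1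
  apply_eq : φ b₀ = 1
  eq_smul : ∀ φ₁ φ₂ : StrongDual ℂ B, φ = φ₁ + φ₂ → ‖φ₁‖ + ‖φ₂‖ ≤ 1 → φ₁ = (‖φ₁‖ : ℂ) • φ

lemma norm_add_norm_le_of_forall {φ₁ φ₂ : StrongDual ℂ B}
    (h : ∀ b₁ b₂ : B, ‖b₁‖ ≤ 1 → ‖b₂‖ ≤ 1 → ‖φ₁ b₁ + φ₂ b₂‖ ≤ 1) : ‖φ₁‖ + ‖φ₂‖ ≤ 1 := by
  have phase : ∀ (φ : StrongDual ℂ B) (b : B), ‖b‖ ≤ 1 →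
      ∃ b' : B, ‖b'‖ ≤ 1 ∧ φ b' = (‖φ b‖ : ℂ) := by
    intro φ b hb
    rcases eq_or_ne (φ b) 0 with h0 | h0
    · exact ⟨b, hb, by simp [h0]⟩
    · refine ⟨((‖φ b‖ : ℂ) * (φ b)⁻¹) • b, ?_, ?_⟩
      · rw [norm_smul, norm_mul, norm_inv, Complex.norm_real, norm_norm,
          mul_inv_cancel₀ (norm_ne_zero_iff.mpr h0), one_mul]
        exact hb
      · rw [map_smul, smul_eq_mul, mul_assoc, inv_mul_cancel₀ h0, mul_one]
  have hsum : ∀ b₁ b₂ : B, ‖b₁‖ ≤ 1 → ‖b₂‖ ≤ 1 → ‖φ₁ b₁‖ + ‖φ₂ b₂‖ ≤ 1 := by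
    intro b₁ b₂ h₁ h₂
    obtain ⟨c₁, hc₁, he₁⟩ := phase φ₁ b₁ h₁
    obtain ⟨c₂, hc₂, he₂⟩ := phase φ₂ b₂ h₂
    have := h c₁ c₂ hc₁ hc₂
    rw [he₁, he₂, ← Complex.ofReal_add, Complex.norm_real, Real.norm_eq_abs,
      abs_of_nonneg (by positivity)] at this
    exact this
  have bound : ∀ (φ : StrongDual ℂ B) (r : ℝ), 0 ≤ r → (∀ b, ‖b‖ ≤ 1 → ‖φ b‖ ≤ r) → ‖φ‖ ≤ r :=
    fun φ r hr hφ => ContinuousLinearMap.opNorm_le_of_unit_norm hr fun b hb => hφ b hb.le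
  have h₂ : ∀ b₁ : B, ‖b₁‖ ≤ 1 → ‖φ₂‖ ≤ 1 - ‖φ₁ b₁‖ := by
    intro b₁ hb₁
    refine bound _ _ ?_ fun b₂ hb₂ => by linarith [hsum b₁ b₂ hb₁ hb₂]
    have := hsum b₁ 0 hb₁ (by simp)
    rw [map_zero, norm_zero] at this
    linarith
  have h₁ : ‖φ₁‖ ≤ 1 - ‖φ₂‖ := by
    refine bound _ _ ?_ fun b₁ hb₁ => by linarith [h₂ b₁ hb₁]
    have := h₂ 0 (by simp)
    rw [map_zero, norm_zero] at this
    linarith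
  linarith

lemma exists_isPureAt {b₀ : B} (hb₀ : ‖b₀‖ = 1) : ∃ φ : StrongDual ℂ B, IsPureAt φ b₀ := by
  let S : Set (WeakDual ℂ B) :=
    (WeakDual.toStrongDual ⁻¹' Metric.closedBall 0 1) ∩ {φ | φ b₀ = 1}
  have hScompact : IsCompact S :=
    (WeakDual.isCompact_closedBall (0 : StrongDual ℂ B) 1).inter_right
      (isClosed_eq (WeakDual.eval_continuous b₀) continuous_const)
  have hSne : S.Nonempty := by
    obtain ⟨φ, hφ, hφb⟩ := exists_dual_vector ℂ b₀ (by rw [← norm_ne_zero_iff, hb₀]; simp)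
    refine ⟨StrongDual.toWeakDual φ, ?_, ?_⟩
    · simp [hφ]
    · change φ b₀ = 1
      rw [hφb, hb₀]; simp
  have hlc : LocallyConvexSpace ℝ (WeakDual ℂ B) :=
    WeakBilin.locallyConvexSpace (B := topDualPairing ℂ B)
  obtain ⟨φ, hφ⟩ := hScompact.extremePoints_nonempty hSne
  rw [mem_extremePoints] at hφ
  obtain ⟨hφS, hext⟩ := hφ
  have hnorm : ‖WeakDual.toStrongDual φ‖ ≤ 1 := by simpa using hφS.1
  have hval : WeakDual.toStrongDual φ b₀ = 1 := hφS.2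
  refine ⟨WeakDual.toStrongDual φ, hnorm, hval, ?_⟩
  intro φ₁ φ₂ hsum hle
  set r₁ := ‖φ₁‖ with hr₁
  set r₂ := ‖φ₂‖ with hr₂
  have hz : φ₁ b₀ + φ₂ b₀ = 1 := by rw [← hval, hsum]; rfl
  have hz₁ : ‖φ₁ b₀‖ ≤ r₁ := by simpa [hb₀] using φ₁.le_opNorm b₀
  have hz₂ : ‖φ₂ b₀‖ ≤ r₂ := by simpa [hb₀] using φ₂.le_opNorm b₀
  have hre : (φ₁ b₀).re + (φ₂ b₀).re = 1 := by rw [← Complex.add_re, hz, Complex.one_re]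
  have hre₁ := Complex.re_le_norm (φ₁ b₀)
  have hre₂ := Complex.re_le_norm (φ₂ b₀)
  have hsum1 : r₁ + r₂ = 1 := by linarith
  have real : ∀ (z : ℂ) (r : ℝ), ‖z‖ = r → z.re = r → z = r := by
    intro z r h h'
    rw [← h'] at h ⊢
    have := Complex.re_eq_norm.mp h.symm
    exact Complex.ext rfl (by simpa using (Complex.nonneg_iff.mp this).2.symm)
  have he₁ : φ₁ b₀ = r₁ := real _ _ (by linarith) (by linarith)
  have he₂ : φ₂ b₀ = r₂ := real _ _ (by linarith) (by linarith)
  rcases eq_or_ne r₁ 0 with h0 | h0₁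
  · rw [h0, Complex.ofReal_zero]
    exact (norm_eq_zero.mp h0).trans (zero_smul ℂ (WeakDual.toStrongDual φ : StrongDual ℂ B)).symm
  rcases eq_or_ne r₂ 0 with h0 | h0₂
  · have : φ₂ = 0 := norm_eq_zero.mp h0
    have h1 : r₁ = 1 := by linarith
    rw [hsum, this, add_zero, h1, Complex.ofReal_one, one_smul]
  have hpos₁ : 0 < r₁ := lt_of_le_of_ne (norm_nonneg _) h0₁.symm
  have hpos₂ : 0 < r₂ := lt_of_le_of_ne (norm_nonneg _) h0₂.symm
  have hmem : ∀ (ψ : StrongDual ℂ B) (r : ℝ), ‖ψ‖ = r → r ≠ 0 → ψ b₀ = r →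
      StrongDual.toWeakDual (((r⁻¹ : ℝ) : ℂ) • ψ) ∈ S := by
    intro ψ r hψ hr hψb
    constructor
    · have : ‖((r⁻¹ : ℝ) : ℂ) • ψ‖ = 1 := by
        rw [norm_smul, Complex.norm_real, norm_inv, Real.norm_eq_abs,
          abs_of_nonneg (hψ ▸ norm_nonneg ψ), hψ, inv_mul_cancel₀ hr]
      simpa using this.le
    · change ((r⁻¹ : ℝ) : ℂ) * ψ b₀ = 1
      rw [hψb, ← Complex.ofReal_mul, inv_mul_cancel₀ hr, Complex.ofReal_one]
  have hinv : ∀ (ψ : StrongDual ℂ B) (r : ℝ), r ≠ 0 → (r : ℂ) • ((r⁻¹ : ℝ) : ℂ) • ψ = ψ := by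
    intro ψ r hr
    rw [smul_smul, ← Complex.ofReal_mul, mul_inv_cancel₀ hr, Complex.ofReal_one, one_smul]
  have hseg : φ ∈ openSegment ℝ (StrongDual.toWeakDual (((r₁⁻¹ : ℝ) : ℂ) • φ₁))
      (StrongDual.toWeakDual (((r₂⁻¹ : ℝ) : ℂ) • φ₂)) := by
    refine ⟨r₁, r₂, hpos₁, hpos₂, hsum1, ?_⟩
    have h1 : (r₁ : ℂ) • (((r₁⁻¹ : ℝ) : ℂ) • φ₁) + (r₂ : ℂ) • (((r₂⁻¹ : ℝ) : ℂ) • φ₂) =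
        WeakDual.toStrongDual φ := by
      rw [hinv _ _ h0₁, hinv _ _ h0₂, hsum]
    exact h1
  have hfin := (hext _ (hmem φ₁ r₁ hr₁.symm h0₁ he₁) _ (hmem φ₂ r₂ hr₂.symm h0₂ he₂) hseg).1
  have hfin' : ((r₁⁻¹ : ℝ) : ℂ) • φ₁ = WeakDual.toStrongDual φ := by rw [← hfin]; rfl
  rw [← hfin', hinv _ _ h0₁]

end PureFunctionals

section Slices

lemma exists_functional_comp_eq {E F : Type*} [NormedAddCommGroup E] [NormedSpace ℂ E]
    [NormedAddCommGroup F] [NormedSpace ℂ F] (T : E →ₗ[ℂ] F) (hT : ∀ x, ‖x‖ ≤ ‖T x‖)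
    (φ : StrongDual ℂ E) : ∃ ω : StrongDual ℂ F, ‖ω‖ ≤ ‖φ‖ ∧ ∀ x, ω (T x) = φ x := by
  have hinj : Function.Injective T := (injective_iff_map_eq_zero T).mpr fun x hx => by
    have := hT x
    rw [hx, norm_zero] at this
    exact norm_le_zero_iff.mp this
  let e := LinearEquiv.ofInjective T hinj
  let ψ : StrongDual ℂ (LinearMap.range T) :=
    LinearMap.mkContinuous ((φ : E →ₗ[ℂ] ℂ) ∘ₗ (e.symm : LinearMap.range T →ₗ[ℂ] E)) ‖φ‖ (by
      intro y
      obtain ⟨x, rfl⟩ := e.surjective y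
      simp only [LinearMap.comp_apply, LinearEquiv.coe_coe, LinearEquiv.symm_apply_apply]
      exact (φ.le_opNorm x).trans (mul_le_mul_of_nonneg_left (hT x) (norm_nonneg _)))
  obtain ⟨ω, hω, hnorm⟩ := exists_extension_norm_eq (LinearMap.range T) ψ
  refine ⟨ω, hnorm ▸ LinearMap.mkContinuous_norm_le _ (norm_nonneg _) _, fun x => ?_⟩
  have h1 := hω (e x)
  have h2 : ψ (e x) = φ x := by
    simp only [ψ, LinearMap.mkContinuous_apply, LinearMap.comp_apply, LinearEquiv.coe_coe,
      LinearEquiv.symm_apply_apply]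
    rfl
  rw [h2] at h1
  exact h1

variable {B C D : Type*} [NonUnitalCStarAlgebra B] [NonUnitalCStarAlgebra C]
  [NonUnitalCStarAlgebra D]

/-- The functional `b ↦ ω (f b * d)`. -/
noncomputable def sliceFunctional (f : B →⋆ₙₐ[ℂ] D) (ω : StrongDual ℂ D) (d : D) : StrongDual ℂ B :=
  LinearMap.mkContinuous
    { toFun := fun b => ω (f b * d)
      map_add' := fun x y => by rw [map_add, add_mul, map_add]
      map_smul' := fun r x => by rw [map_smul, smul_mul_assoc, map_smul, RingHom.id_apply] }
    (‖ω‖ * ‖d‖) (fun b => by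
      change ‖ω (f b * d)‖ ≤ _
      calc ‖ω (f b * d)‖ ≤ ‖ω‖ * ‖f b * d‖ := ω.le_opNorm _
        _ ≤ ‖ω‖ * (‖b‖ * ‖d‖) := by
          gcongr
          exact (norm_mul_le _ _).trans
            (mul_le_mul_of_nonneg_right (NonUnitalStarAlgHom.norm_apply_le f b) (norm_nonneg _))
        _ = ‖ω‖ * ‖d‖ * ‖b‖ := by ring)

@[simp]
lemma sliceFunctional_apply (f : B →⋆ₙₐ[ℂ] D) (ω : StrongDual ℂ D) (d : D) (b : B) :
    sliceFunctional f ω d b = ω (f b * d) := rfl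

variable [PartialOrder C] [StarOrderedRing C] [PartialOrder D] [StarOrderedRing D]

/-- A functional on `D` that extends a pure functional of the first factor along a compression is
a product functional. -/
lemma apply_map_mul_map_conj (f : B →⋆ₙₐ[ℂ] D) (g : C →⋆ₙₐ[ℂ] D)
    (hcomm : ∀ b c, Commute (f b) (g c)) {φ : StrongDual ℂ B} {b₀ : B} (hφ : IsPureAt φ b₀)
    {s : C} (hs : 0 ≤ s) (hs1 : ‖s‖ ≤ 1) {ω : StrongDual ℂ D} (hω : ‖ω‖ ≤ 1)
    (hωφ : ∀ b, ω (f b * g (s * s)) = φ b) (x : C) (b : B) :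
    ω (f b * g (s * x * s)) = ω (f b₀ * g (s * x * s)) * φ b := by
  have hx : x ∈ Submodule.span ℂ ({x : C | 0 ≤ x} ∩ Metric.closedBall 0 1) := by
    rw [CStarAlgebra.span_nonneg_inter_unitClosedBall]; trivial
  induction hx using Submodule.span_induction with
  | zero => simp
  | add x y _ _ hx hy =>
    simp only [mul_add, add_mul, map_add] at hx hy ⊢
    rw [hx, hy]
  | smul a x _ hx =>
    simp only [mul_smul_comm, smul_mul_assoc, map_smul, smul_eq_mul] at hx ⊢
    rw [hx]; ring
  | mem x hx =>
    obtain ⟨hx0, hx1⟩ := hx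
    have hx0 : 0 ≤ x := hx0
    rw [mem_closedBall_zero_iff] at hx1
    have hsa : IsSelfAdjoint s := .of_nonneg hs
    have hα : 0 ≤ s * x * s := by simpa [hsa.star_eq] using star_right_conjugate_nonneg hx0 s
    have hβ : 0 ≤ s * s - s * x * s := by
      rw [sub_nonneg]
      calc s * x * s = s * x * star s := by rw [hsa.star_eq]
        _ ≤ ‖x‖ • (s * star s) := CStarAlgebra.star_right_conjugate_le_norm_smul
        _ ≤ (1 : ℝ) • (s * star s) :=
          smul_le_smul_of_nonneg_right hx1 (mul_star_self_nonneg s)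
        _ = s * s := by rw [one_smul, hsa.star_eq]
    set α := s * x * s with hα'
    set β := s * s - α with hβ'
    have hα2 : CFC.sqrt α * CFC.sqrt α = α := CFC.sqrt_mul_sqrt_self α hα
    have hβ2 : CFC.sqrt β * CFC.sqrt β = β := CFC.sqrt_mul_sqrt_self β hβ
    have hsaα : IsSelfAdjoint (g (CFC.sqrt α)) := (IsSelfAdjoint.of_nonneg (CFC.sqrt_nonneg α)).map g
    have hsaβ : IsSelfAdjoint (g (CFC.sqrt β)) := (IsSelfAdjoint.of_nonneg (CFC.sqrt_nonneg β)).map g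
    have hαβ : ‖g (CFC.sqrt α) * g (CFC.sqrt α) + g (CFC.sqrt β) * g (CFC.sqrt β)‖ ≤ 1 := by
      rw [← map_mul, ← map_mul, ← map_add, hα2, hβ2, hβ', add_sub_cancel]
      exact (NonUnitalStarAlgHom.norm_apply_le g _).trans
        ((norm_mul_le _ _).trans (mul_le_one₀ hs1 (norm_nonneg _) hs1))
    have hdec : φ = sliceFunctional f ω (g α) + sliceFunctional f ω (g β) := by
      ext b
      rw [add_apply, sliceFunctional_apply, sliceFunctional_apply, ← map_add,
        ← mul_add, ← map_add, hβ', add_sub_cancel, hωφ]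
    have hle : ‖sliceFunctional f ω (g α)‖ + ‖sliceFunctional f ω (g β)‖ ≤ 1 := by
      refine norm_add_norm_le_of_forall fun b₁ b₂ hb₁ hb₂ => ?_
      rw [sliceFunctional_apply, sliceFunctional_apply, ← map_add]
      refine (ω.le_opNorm _).trans (mul_le_one₀ hω (norm_nonneg _) ?_)
      rw [← hα2, ← hβ2, map_mul, map_mul]
      exact norm_mul_sq_add_mul_sq_le ((NonUnitalStarAlgHom.norm_apply_le f _).trans hb₁)
        ((NonUnitalStarAlgHom.norm_apply_le f _).trans hb₂) hsaα hsaβ (hcomm _ _) (hcomm _ _) hαβ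
    have h := hφ.eq_smul _ _ hdec hle
    have happ : ∀ b, ω (f b * g α) = (‖sliceFunctional f ω (g α)‖ : ℂ) * φ b := fun b =>
      congrArg (fun ψ : StrongDual ℂ B => ψ b) h
    rw [happ b, happ b₀, hφ.apply_eq, mul_one]

lemma norm_slice_le_of_nonneg (f : B →⋆ₙₐ[ℂ] D) (g : C →⋆ₙₐ[ℂ] D)
    (hcomm : ∀ b c, Commute (f b) (g c)) (hcross : ∀ b c, ‖b‖ * ‖c‖ ≤ ‖f b * g c‖)
    {φ : StrongDual ℂ B} {b₀ : B} (hb₀ : ‖b₀‖ ≤ 1) (hφ : IsPureAt φ b₀) {ι : Type*}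
    (S : Finset ι) (u : ι → B) (v : ι → C) (hpos : 0 ≤ ∑ k ∈ S, φ (u k) • v k) :
    ‖∑ k ∈ S, φ (u k) • v k‖ ≤ ‖∑ k ∈ S, f (u k) * g (v k)‖ := by
  set v₀ := ∑ k ∈ S, φ (u k) • v k with hv₀
  set t := ∑ k ∈ S, f (u k) * g (v k) with ht
  rcases eq_or_ne v₀ 0 with h0 | h0
  · rw [h0, norm_zero]; exact norm_nonneg _
  refine le_of_forall_pos_le_add fun ε hε => ?_
  obtain ⟨s, hs, hs1, hsε⟩ := exists_compression_near_norm hpos h0 hε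
  have hsa : IsSelfAdjoint s := .of_nonneg hs
  have hss : ‖s * s‖ = 1 := by
    have := CStarRing.norm_star_mul_self (x := s)
    rwa [hsa.star_eq, hs1, one_mul] at this
  obtain ⟨ω, hω, hωφ⟩ := exists_functional_comp_eq
    ({ toFun := fun b => f b * g (s * s)
       map_add' := fun x y => by rw [map_add, add_mul]
       map_smul' := fun r x => by rw [map_smul, smul_mul_assoc, RingHom.id_apply] } : B →ₗ[ℂ] D)
    (fun b => by simpa [hss] using hcross b (s * s)) φ
  replace hω := hω.trans hφ.norm_le
  replace hωφ : ∀ b, ω (f b * g (s * s)) = φ b := hωφ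
  have hprod := apply_map_mul_map_conj f g hcomm hφ hs hs1.le hω hωφ
  have hgs : ‖g s‖ ≤ 1 := (NonUnitalStarAlgHom.norm_apply_le g s).trans hs1.le
  have hfb1 : ‖f b₀‖ ≤ 1 := (NonUnitalStarAlgHom.norm_apply_le f b₀).trans hb₀
  have hfb₀ : ∀ y : C, ‖ω (f b₀ * g y)‖ ≤ ‖f b₀‖ * ‖y‖ := fun y => by
    refine (ω.le_opNorm _).trans ((mul_le_of_le_one_left (norm_nonneg _) hω).trans ?_)
    exact (norm_mul_le _ _).trans
      (mul_le_mul_of_nonneg_left (NonUnitalStarAlgHom.norm_apply_le g y) (norm_nonneg _))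
  have hcalc : ω (g s * t * g s) = ω (f b₀ * g (s * v₀ * s)) := by
    have h1 : g s * t * g s = ∑ k ∈ S, f (u k) * g (s * v k * s) := by
      rw [ht, Finset.mul_sum, Finset.sum_mul]
      refine Finset.sum_congr rfl fun k _ => ?_
      rw [← mul_assoc (g s), ← (hcomm (u k) s).eq]
      simp only [map_mul, mul_assoc]
    have h2 : s * v₀ * s = ∑ k ∈ S, φ (u k) • (s * v k * s) := by
      rw [hv₀, Finset.mul_sum, Finset.sum_mul]
      simp only [mul_smul_comm, smul_mul_assoc]
    rw [h1, h2, map_sum, map_sum, Finset.mul_sum, map_sum]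
    refine Finset.sum_congr rfl fun k _ => ?_
    rw [hprod, map_smul, mul_smul_comm, map_smul, smul_eq_mul, mul_comm]
  have hclose : ‖ω (f b₀ * g (s * v₀ * s)) - (‖v₀‖ : ℂ)‖ ≤ ε := by
    have h1 : (‖v₀‖ : ℂ) = ω (f b₀ * g (‖v₀‖ • (s * s))) := by
      rw [← Complex.coe_smul, map_smul, mul_smul_comm, map_smul, hωφ, hφ.apply_eq, smul_eq_mul,
        mul_one]
    rw [h1, ← map_sub, ← mul_sub, ← map_sub]
    exact (hfb₀ _).trans ((mul_le_of_le_one_left (norm_nonneg _) hfb1).trans hsε)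
  have hup : ‖ω (g s * t * g s)‖ ≤ ‖t‖ := by
    refine (ω.le_opNorm _).trans ((mul_le_of_le_one_left (norm_nonneg _) hω).trans ?_)
    refine (norm_mul_le _ _).trans ((mul_le_of_le_one_right (norm_nonneg _) hgs).trans ?_)
    exact (norm_mul_le _ _).trans (mul_le_of_le_one_left (norm_nonneg _) hgs)
  rw [hcalc] at hup
  have hv : ‖(‖v₀‖ : ℂ)‖ = ‖v₀‖ := by rw [Complex.norm_real, norm_norm]
  have h3 := norm_sub_norm_le (‖v₀‖ : ℂ) (ω (f b₀ * g (s * v₀ * s)))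
  rw [norm_sub_rev, hv] at h3
  linarith

/-- Slice maps of pure functionals are contractive for every C⋆-norm. -/
lemma norm_slice_le (f : B →⋆ₙₐ[ℂ] D) (g : C →⋆ₙₐ[ℂ] D)
    (hcomm : ∀ b c, Commute (f b) (g c)) (hcross : ∀ b c, ‖b‖ * ‖c‖ ≤ ‖f b * g c‖)
    {φ : StrongDual ℂ B} {b₀ : B} (hb₀ : ‖b₀‖ ≤ 1) (hφ : IsPureAt φ b₀) {ι : Type*}
    (S : Finset ι) (u : ι → B) (v : ι → C) :
    ‖∑ k ∈ S, φ (u k) • v k‖ ≤ ‖∑ k ∈ S, f (u k) * g (v k)‖ := by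
  set v₀ := ∑ k ∈ S, φ (u k) • v k with hv₀
  set t := ∑ k ∈ S, f (u k) * g (v k) with ht
  have hsq : star v₀ * v₀ = ∑ k ∈ S, φ (u k) • (star v₀ * v k) := by
    conv_lhs => rw [hv₀, Finset.mul_sum]
    simp only [mul_smul_comm, ← hv₀]
  have h := norm_slice_le_of_nonneg f g hcomm hcross hb₀ hφ S u (fun k => star v₀ * v k)
    (hsq ▸ star_mul_self_nonneg v₀)
  have ht' : ∑ k ∈ S, f (u k) * g (star v₀ * v k) = g (star v₀) * t := by
    rw [ht, Finset.mul_sum]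
    refine Finset.sum_congr rfl fun k _ => ?_
    rw [map_mul, ← mul_assoc, (hcomm _ _).eq, mul_assoc]
  rw [← hsq, ht', CStarRing.norm_star_mul_self] at h
  have hg : ‖g (star v₀)‖ ≤ ‖v₀‖ := (NonUnitalStarAlgHom.norm_apply_le g _).trans (norm_star v₀).le
  have h2 : ‖v₀‖ * ‖v₀‖ ≤ ‖v₀‖ * ‖t‖ :=
    h.trans ((norm_mul_le _ _).trans (mul_le_mul_of_nonneg_right hg (norm_nonneg _)))
  rcases (norm_nonneg v₀).eq_or_lt with h0 | h0
  · rw [← h0]; exact norm_nonneg _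
  · exact le_of_mul_le_mul_left h2 h0

end Slices

section Separation

variable {B C D : Type*} [NonUnitalCStarAlgebra B] [NonUnitalCStarAlgebra C]
  [NonUnitalCStarAlgebra D]

lemma exists_sum_near_of_dense (f : B →⋆ₙₐ[ℂ] D) (g : C →⋆ₙₐ[ℂ] D)
    (hdense : Dense (Submodule.span ℂ {x : D | ∃ (b : B) (c : C), x = f b * g c} : Set D))
    (e : D) {ε : ℝ} (hε : 0 < ε) :
    ∃ (K : ℕ) (u : Fin K → B) (v : Fin K → C), ‖(∑ k, f (u k) * g (v k)) - e‖ ≤ ε := by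
  obtain ⟨t, ht, hte⟩ := Metric.mem_closure_iff.mp (hdense e) ε hε
  obtain ⟨K, a, x, hx⟩ := Submodule.mem_span_set'.mp ht
  choose u v huv using fun k => (x k).2
  refine ⟨K, fun k => a k • u k, v, ?_⟩
  have : ∑ k, f (a k • u k) * g (v k) = t := by
    rw [← hx]
    refine Finset.sum_congr rfl fun k _ => ?_
    rw [huv k, map_smul, smul_mul_assoc]
  rw [this, ← dist_eq_norm, dist_comm]
  exact hte.le

variable [PartialOrder C] [StarOrderedRing C] [PartialOrder D] [StarOrderedRing D]

/-- No element of a C⋆-tensor product separates the diagonal from the off-diagonal of an infinite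
matrix of elementary tensors. -/
lemma false_of_separates_diagonal (f : B →⋆ₙₐ[ℂ] D) (g : C →⋆ₙₐ[ℂ] D)
    (hcomm : ∀ b c, Commute (f b) (g c)) (hcross : ∀ b c, ‖b‖ * ‖c‖ ≤ ‖f b * g c‖)
    (hdense : Dense (Submodule.span ℂ {x : D | ∃ (b : B) (c : C), x = f b * g c} : Set D))
    {b : ℕ → B} {c : ℕ → C} (hb : ∀ n, ‖b n‖ = 1) (hc : ∀ n, ‖c n‖ = 1) {e : D}
    (hdiag : ∀ n, e * (f (b n) * g (c n)) = f (b n) * g (c n))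
    (hoff : ∀ m n, m ≠ n → e * (f (b m) * g (c n)) = 0) : False := by
  obtain ⟨K, u, v, ht⟩ := exists_sum_near_of_dense f g hdense e (ε := 1 / 8) (by norm_num)
  set t := ∑ k, f (u k) * g (v k) with ht'
  choose φ hφ using fun n => exists_isPureAt (hb n)
  let z : ℕ → Fin K → ℂ := fun n k => φ n (u k * b n)
  let V : (Fin K → ℂ) → C := fun w => ∑ k, w k • v k
  have hVcont : Continuous V := by fun_prop
  have hfg : ∀ m n, ‖f (b m) * g (c n)‖ ≤ 1 := fun m n =>
    (norm_mul_le _ _).trans (mul_le_one₀ ((NonUnitalStarAlgHom.norm_apply_le f _).trans (hb m).le)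
      (norm_nonneg _) ((NonUnitalStarAlgHom.norm_apply_le g _).trans (hc n).le))
  have hnear : ∀ m n, ‖t * (f (b m) * g (c n)) - e * (f (b m) * g (c n))‖ ≤ 1 / 8 := fun m n => by
    rw [← sub_mul]
    exact (norm_mul_le _ _).trans ((mul_le_of_le_one_right (norm_nonneg _) (hfg m n)).trans ht)
  have hmul : ∀ m n, t * (f (b m) * g (c n)) = ∑ k, f (u k * b m) * g (v k * c n) := fun m n => by
    rw [ht', Finset.sum_mul]
    refine Finset.sum_congr rfl fun k _ => ?_
    rw [map_mul, map_mul, mul_assoc, ← mul_assoc (g (v k)), ← (hcomm (b m) (v k)).eq]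
    simp only [mul_assoc]
  have hVmul : ∀ m n, V (z m) * c n = ∑ k, φ m (u k * b m) • (v k * c n) := fun m n => by
    simp only [V, z, Finset.sum_mul, smul_mul_assoc]
  have hVoff : ∀ m n, m ≠ n → ‖V (z m) * c n‖ ≤ 1 / 8 := fun m n hmn => by
    have h1 := hnear m n
    rw [hoff m n hmn, sub_zero, hmul] at h1
    rw [hVmul]
    exact (norm_slice_le f g hcomm hcross (hb m).le (hφ m) Finset.univ _ _).trans h1
  have hVdiag : ∀ n, ‖V (z n) * c n - c n‖ ≤ 1 / 8 := fun n => by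
    have h1 := hnear n n
    rw [hdiag n, hmul] at h1
    have h2 := norm_slice_le f g hcomm hcross (hb n).le (hφ n) (Finset.univ : Finset (Option (Fin K)))
      (fun k => k.elim (b n) fun k => u k * b n) (fun k => k.elim (-c n) fun k => v k * c n)
    simp only [Fintype.sum_option, Option.elim_none, Option.elim_some, (hφ n).apply_eq, one_smul,
      map_neg, mul_neg, ← hVmul, neg_add_eq_sub] at h2
    exact h2.trans h1
  have hz : ∀ n, z n ∈ Metric.closedBall (0 : Fin K → ℂ) (∑ k, ‖u k‖) := fun n => by
    rw [mem_closedBall_zero_iff, pi_norm_le_iff_of_nonneg (by positivity)]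
    intro k
    calc ‖φ n (u k * b n)‖ ≤ ‖φ n‖ * ‖u k * b n‖ := (φ n).le_opNorm _
      _ ≤ ‖u k * b n‖ := mul_le_of_le_one_left (norm_nonneg _) (hφ n).norm_le
      _ ≤ ‖u k‖ * ‖b n‖ := norm_mul_le _ _
      _ = ‖u k‖ := by rw [hb, mul_one]
      _ ≤ ∑ k, ‖u k‖ := Finset.single_le_sum (fun k _ => norm_nonneg (u k)) (Finset.mem_univ k)
  obtain ⟨a, -, θ, hθ, hlim⟩ := tendsto_subseq_of_bounded Metric.isBounded_closedBall hz
  have hcauchy := ((hVcont.tendsto a).comp hlim).cauchySeq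
  obtain ⟨N, hN⟩ := Metric.cauchySeq_iff.mp hcauchy (1 / 8) (by norm_num)
  have hclose := hN (N + 1) (by simp) N le_rfl
  have hne : θ N ≠ θ (N + 1) := (hθ N.lt_succ_self).ne
  set m := θ N with hm
  set n := θ (N + 1) with hn
  replace hclose : ‖V (z n) - V (z m)‖ < 1 / 8 := by rw [← dist_eq_norm]; exact hclose
  have h1 : ‖(V (z n) - V (z m)) * c n‖ ≤ 1 / 8 :=
    (norm_mul_le _ _).trans (by rw [hc, mul_one]; exact hclose.le)
  have h2 : c n = (V (z n) - V (z m)) * c n + V (z m) * c n - (V (z n) * c n - c n) := by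
    rw [sub_mul]; abel
  have h3 : ‖c n‖ ≤ 1 / 8 + 1 / 8 + 1 / 8 := by
    rw [h2]
    exact (norm_sub_le _ _).trans
      (add_le_add ((norm_add_le _ _).trans (add_le_add h1 (hVoff m n hne))) (hVdiag n))
  rw [hc] at h3
  norm_num at h3

end Separation

section Assembly

lemma isSelfAdjoint_mul_self {R : Type*} [Mul R] [StarMul R] {x : R} (hx : IsSelfAdjoint x) :
    IsSelfAdjoint (x * x) := by
  rw [IsSelfAdjoint, star_mul, hx.star_eq]

lemma mul_self_ne_zero_of_isSelfAdjoint {E : Type*} [NonUnitalNormedRing E] [StarRing E]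
    [CStarRing E] {x : E} (hx : IsSelfAdjoint x) (hx0 : x ≠ 0) : x * x ≠ 0 := by
  have := (CStarRing.star_mul_self_ne_zero_iff x).mpr hx0
  rwa [hx.star_eq] at this

variable {B C D : Type*} [NonUnitalCStarAlgebra B] [NonUnitalCStarAlgebra C]
  [NonUnitalCStarAlgebra D]

lemma eq_zero_or_eq_zero_of_map_mul_map_eq_zero (f : B →⋆ₙₐ[ℂ] D) (g : C →⋆ₙₐ[ℂ] D)
    (T : TensorProduct ℂ B C →ₗ[ℂ] D) (hT : ∀ b c, T (TensorProduct.tmul ℂ b c) = f b * g c)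
    (hinj : Function.Injective T) (b : B) (c : C) (h : f b * g c = 0) : b = 0 ∨ c = 0 := by
  by_contra! hbc
  have h0 : TensorProduct.tmul ℂ b c = 0 := hinj (by rw [hT, h, map_zero])
  obtain ⟨φ, -, hφ⟩ := exists_dual_vector ℂ b (norm_ne_zero_iff.mpr hbc.1)
  obtain ⟨ψ, -, hψ⟩ := exists_dual_vector ℂ c (norm_ne_zero_iff.mpr hbc.2)
  have h1 := congrArg (TensorProduct.lift
    ((LinearMap.mul ℂ ℂ).compl₁₂ (φ : B →ₗ[ℂ] ℂ) (ψ : C →ₗ[ℂ] ℂ))) h0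
  simp [hφ, hψ, hbc.1, hbc.2] at h1

variable [PartialOrder D] [StarOrderedRing D]

/-- In a SAW⋆-algebra, a countable family of pairwise orthogonal positive elements can be separated
along any partition of the index set into two pieces. -/
lemma exists_separating_of_isSAWStar (hD : IsSAWStar D) {ι : Type*} [Encodable ι] (d : ι → D)
    (hd : ∀ i, 0 ≤ d i) (horth : ∀ i j, i ≠ j → d i * d j = 0) (S : Set ι) :
    ∃ e : D, (∀ i ∈ S, e * (d i * d i) = d i * d i) ∧ ∀ i ∉ S, e * (d i * d i) = 0 := by
  classical
  let r : ι → ℝ := fun i => (1 / 2) ^ Encodable.encode i / (1 + ‖d i‖)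
  have hr : ∀ i, 0 < r i := fun i => by positivity
  let w : Set ι → ι → D := fun T => T.indicator fun i => r i • d i
  have hw0 : ∀ T i, 0 ≤ w T i := fun T => Set.indicator_nonneg fun i _ =>
    smul_nonneg (hr i).le (hd i)
  have hsum : ∀ T, Summable (w T) := fun T => by
    refine Summable.indicator (.of_norm_bounded summable_geometric_two_encode fun i => ?_) T
    rw [norm_smul, Real.norm_eq_abs, abs_of_pos (hr i), div_mul_eq_mul_div]
    refine div_le_of_le_mul₀ (by positivity) (by positivity) ?_
    gcongr
    linarith
  have hmul : ∀ T i, (∑' j, w T j) * d i = w T i * d i := fun T i => by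
    rw [← (hsum T).tsum_mul_right, tsum_eq_single i]
    intro j hj
    by_cases hjT : j ∈ T
    · simp [w, hjT, smul_mul_assoc, horth j i hj]
    · simp [w, hjT]
  obtain ⟨e, -, hex, hey⟩ := hD (∑' i, w S i) (∑' i, w Sᶜ i) (tsum_nonneg (hw0 S))
    (tsum_nonneg (hw0 Sᶜ)) (by
      rw [← (hsum Sᶜ).tsum_mul_left]
      refine (tsum_congr fun i => ?_).trans tsum_zero
      by_cases hi : i ∈ S
      · simp [w, hi]
      · simp only [w, Set.indicator_of_mem (Set.mem_compl hi), mul_smul_comm]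
        rw [hmul]
        simp [w, hi])
  have hcancel : ∀ i (y z : D), r i • y = r i • z → y = z := fun i y z h =>
    (smul_right_injective D (hr i).ne') h
  refine ⟨e, fun i hi => hcancel i _ _ ?_, fun i hi => hcancel i _ _ ?_⟩
  · have h := congrArg (· * d i) hex
    simp only [mul_assoc, hmul, w, Set.indicator_of_mem hi] at h
    simpa only [mul_smul_comm, smul_mul_assoc] using h
  · have h := congrArg (· * d i) hey
    simp only [mul_assoc, hmul, w, Set.indicator_of_mem (Set.mem_compl hi), zero_mul] at h
    simpa only [mul_smul_comm, smul_mul_assoc, smul_zero] using h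

lemma IsSAWStar.of_starAlgEquiv {A : Type*} [NonUnitalCStarAlgebra A] [PartialOrder A]
    [StarOrderedRing A] (hA : IsSAWStar A) (Φ : A ≃⋆ₐ[ℂ] D) : IsSAWStar D := by
  intro x y hx hy hxy
  obtain ⟨e, he, hex, hey⟩ := hA (Φ.symm x) (Φ.symm y) (map_nonneg Φ.symm hx)
    (map_nonneg Φ.symm hy) (by rw [← map_mul, hxy, map_zero])
  refine ⟨Φ e, map_nonneg Φ he, ?_, ?_⟩
  · simpa using congrArg Φ hex
  · simpa using congrArg Φ hey

lemma not_isSAWStar_of_dense_range [PartialOrder B] [StarOrderedRing B] [PartialOrder C]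
    [StarOrderedRing C] (hB : ¬ FiniteDimensional ℂ B) (hC : ¬ FiniteDimensional ℂ C)
    (f : B →⋆ₙₐ[ℂ] D) (g : C →⋆ₙₐ[ℂ] D) (hcomm : ∀ b c, Commute (f b) (g c))
    (hinj : ∀ b c, f b * g c = 0 → b = 0 ∨ c = 0)
    (hdense : Dense (Submodule.span ℂ {x : D | ∃ (b : B) (c : C), x = f b * g c} : Set D)) :
    ¬ IsSAWStar D := by
  intro hD
  obtain ⟨p, hpsa, hp0, hp⟩ := hasOrthogonalSequence_of_not_finiteDimensional hB
  obtain ⟨q, hqsa, hq0, hq⟩ := hasOrthogonalSequence_of_not_finiteDimensional hC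
  have hprod : ∀ (b b' : B) (c c' : C), f b * g c * (f b' * g c') = f (b * b') * g (c * c') := by
    intro b b' c c'
    rw [map_mul, map_mul, mul_assoc, ← mul_assoc (g c), ← (hcomm b' c).eq]
    simp only [mul_assoc]
  let d : ℕ × ℕ → D := fun i => f (p i.1 * p i.1) * g (q i.2 * q i.2)
  have hd : ∀ i, 0 ≤ d i := fun i => by
    have : d i = star (f (p i.1) * g (q i.2)) * (f (p i.1) * g (q i.2)) := by
      rw [star_mul, ← map_star, ← map_star, (hpsa _).star_eq, (hqsa _).star_eq,
        ← (hcomm _ _).eq, hprod]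
    rw [this]
    exact star_mul_self_nonneg _
  have horth : ∀ i j, i ≠ j → d i * d j = 0 := by
    rintro ⟨m, n⟩ ⟨m', n'⟩ hij
    simp only [d, hprod]
    by_cases hm : m = m'
    · have hn : n ≠ n' := fun hn => hij (by rw [hm, hn])
      rw [mul_assoc (q n), ← mul_assoc (q n) (q n'), hq n n' hn]
      simp
    · rw [mul_assoc (p m), ← mul_assoc (p m) (p m'), hp m m' hm]
      simp
  obtain ⟨e, hdiag, hoff⟩ := exists_separating_of_isSAWStar hD d hd horth {i | i.1 = i.2}
  let P : ℕ → B := fun n => p n * p n * (p n * p n)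
  let Q : ℕ → C := fun n => q n * q n * (q n * q n)
  have hP : ∀ n, ‖P n‖ ≠ 0 := fun n => norm_ne_zero_iff.mpr
    (mul_self_ne_zero_of_isSelfAdjoint (isSelfAdjoint_mul_self (hpsa n))
      (mul_self_ne_zero_of_isSelfAdjoint (hpsa n) (hp0 n)))
  have hQ : ∀ n, ‖Q n‖ ≠ 0 := fun n => norm_ne_zero_iff.mpr
    (mul_self_ne_zero_of_isSelfAdjoint (isSelfAdjoint_mul_self (hqsa n))
      (mul_self_ne_zero_of_isSelfAdjoint (hqsa n) (hq0 n)))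
  have hscale : ∀ m n, f ((‖P m‖ : ℂ)⁻¹ • P m) * g ((‖Q n‖ : ℂ)⁻¹ • Q n) =
      ((‖P m‖ : ℂ)⁻¹ * (‖Q n‖ : ℂ)⁻¹) • (d (m, n) * d (m, n)) := fun m n => by
    rw [map_smul, map_smul, smul_mul_smul_comm, hprod]
  refine false_of_separates_diagonal f g hcomm (norm_mul_norm_le f g hcomm hinj) hdense
    (b := fun n => (‖P n‖ : ℂ)⁻¹ • P n) (c := fun n => (‖Q n‖ : ℂ)⁻¹ • Q n) (e := e)
    (fun n => ?_) (fun n => ?_) (fun n => ?_) (fun m n hmn => ?_)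
  · rw [norm_smul, norm_inv, Complex.norm_real, norm_norm, inv_mul_cancel₀ (hP n)]
  · rw [norm_smul, norm_inv, Complex.norm_real, norm_norm, inv_mul_cancel₀ (hQ n)]
  · rw [hscale, mul_smul_comm, hdiag (n, n) rfl]
  · rw [hscale, mul_smul_comm, hoff (m, n) hmn, smul_zero]

end Assembly

/-- No SAW*-algebra is *-isomorphic to a C*-tensor product `B ⊗ν C` of two
infinite-dimensional C*-algebras.  The C*-tensor product is encoded as a C*-algebra `D`
together with *-homomorphisms `f : B → D`, `g : C → D` with commuting ranges, such that
the induced map on the algebraic tensor product `B ⊙ C` is injective (this is what a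
C*-norm on `B ⊙ C` provides) and has dense range (so that `D` is the completion). -/
theorem sawstar_essentially_non_factorizable
    {A : Type*} [NonUnitalNormedRing A] [StarRing A] [CStarRing A] [NormedSpace ℂ A]
    [IsScalarTower ℂ A A] [SMulCommClass ℂ A A] [StarModule ℂ A] [CompleteSpace A]
    [PartialOrder A] [StarOrderedRing A] (hA : IsSAWStar A)
    {B : Type*} [NonUnitalNormedRing B] [StarRing B] [CStarRing B] [NormedSpace ℂ B]
    [IsScalarTower ℂ B B] [SMulCommClass ℂ B B] [StarModule ℂ B] [CompleteSpace B]
    {C : Type*} [NonUnitalNormedRing C] [StarRing C] [CStarRing C] [NormedSpace ℂ C]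
    [IsScalarTower ℂ C C] [SMulCommClass ℂ C C] [StarModule ℂ C] [CompleteSpace C]
    {D : Type*} [NonUnitalNormedRing D] [StarRing D] [CStarRing D] [NormedSpace ℂ D]
    [IsScalarTower ℂ D D] [SMulCommClass ℂ D D] [StarModule ℂ D] [CompleteSpace D]
    (hB : ¬ FiniteDimensional ℂ B) (hC : ¬ FiniteDimensional ℂ C)
    (f : B →⋆ₙₐ[ℂ] D) (g : C →⋆ₙₐ[ℂ] D)
    (hcomm : ∀ (b : B) (c : C), Commute (f b) (g c))
    (hinj : Function.Injective
      (TensorProduct.lift (LinearMap.mk₂ ℂ (fun b c => f b * g c)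
        (fun b b' c => by simp [map_add, add_mul])
        (fun r b c => by simp [map_smul, smul_mul_assoc])
        (fun b c c' => by simp [map_add, mul_add])
        (fun r b c => by simp [map_smul, mul_smul_comm]))))
    (hdense : Dense (Submodule.span ℂ {x : D | ∃ (b : B) (c : C), x = f b * g c} : Set D)) :
    ¬ Nonempty (A ≃⋆ₐ[ℂ] D) := by
  rintro ⟨Φ⟩
  let : NonUnitalCStarAlgebra A := {}
  let : NonUnitalCStarAlgebra B := {}
  let : NonUnitalCStarAlgebra C := {}
  let : NonUnitalCStarAlgebra D := {}
  let : PartialOrder B := CStarAlgebra.spectralOrder B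
  let : PartialOrder C := CStarAlgebra.spectralOrder C
  let : PartialOrder D := CStarAlgebra.spectralOrder D
  have : StarOrderedRing B := CStarAlgebra.spectralOrderedRing B
  have : StarOrderedRing C := CStarAlgebra.spectralOrderedRing C
  have : StarOrderedRing D := CStarAlgebra.spectralOrderedRing D
  exact not_isSAWStar_of_dense_range hB hC f g hcomm
    (eq_zero_or_eq_zero_of_map_mul_map_eq_zero f g _ (fun b c => rfl) hinj) hdense
    (hA.of_starAlgEquiv Φ)
end
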